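/- arXiv:2108.01868 — 3 statements merged into one kernel-verified Lean document; each statement's English description precedes it below -/
import Mathlib

section
/- Let R be a Noetherian local domain of Krull dimension at least 2. Then R contains two distinct prime ideals of height one, and for the associated order-of-vanishing homomorphisms v, v* : K× → ℤ (defined via lengths of modules over the localizations at these primes), there exists β ∈ K× with v(β) < 0 < v*(β). Consequently the R-adic topology on K = Frac(R) is not a V-topology. -/
/-- A prime ideal of a domain has height one iff it is nonzero and there is no prime
strictly between `⊥` and it. -/
def HeightOnePrime {R : Type*} [CommRing R] [IsDomain R] (p : Ideal R) : Prop :=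
  p.IsPrime ∧ p ≠ ⊥ ∧ ∀ q : Ideal R, q.IsPrime → q < p → q = ⊥

theorem heightOnePrime_iff_height_le_one {R : Type*} [CommRing R] [IsDomain R] {p : Ideal R} :
    HeightOnePrime p ↔ p.IsPrime ∧ p ≠ ⊥ ∧ p.height ≤ 1 := by
  refine and_congr_right fun hp ↦ and_congr_right fun _ ↦ ?_
  have h := Ideal.height_le_iff (p := p) (n := 1)
  simp only [Nat.cast_one, Order.lt_one_iff, Ideal.height_eq_zero_iff_eq_bot] at h
  exact h.symm

theorem exists_heightOnePrime_mem {R : Type*} [CommRing R] [IsDomain R] [IsNoetherianRing R]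
    {x : R} (hx0 : x ≠ 0) (hx : ¬ IsUnit x) : ∃ p : Ideal R, HeightOnePrime p ∧ x ∈ p := by
  obtain ⟨p, hp⟩ := Ideal.nonempty_minimalPrimes (I := Ideal.span {x})
    (by rwa [Ne, Ideal.span_singleton_eq_top])
  have hxp : x ∈ p := hp.1.2 (Ideal.mem_span_singleton_self x)
  refine ⟨p, heightOnePrime_iff_height_le_one.2 ⟨hp.1.1, ?_, ?_⟩, hxp⟩
  · rintro rfl
    exact hx0 hxp
  · exact Ideal.height_le_one_of_isPrincipal_of_mem_minimalPrimes _ p hp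

theorem exists_heightOnePrime_ne {R : Type*} [CommRing R] [IsDomain R] [IsLocalRing R]
    [IsNoetherianRing R] (hdim : 2 ≤ ringKrullDim R) :
    ∃ p q : Ideal R, HeightOnePrime p ∧ HeightOnePrime q ∧ p ≠ q := by
  have hm : ¬ (IsLocalRing.maximalIdeal R).height ≤ 1 := by
    intro h
    rw [← IsLocalRing.maximalIdeal_height_eq_ringKrullDim] at hdim
    have h2 : (2 : ℕ∞) ≤ (IsLocalRing.maximalIdeal R).height :=
      WithBot.coe_le_coe.1 hdim
    exact absurd (h2.trans h) (by decide)
  have hm0 : IsLocalRing.maximalIdeal R ≠ ⊥ := by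
    intro h
    simp [h] at hm
  obtain ⟨x, hxm, hx0⟩ := Submodule.exists_mem_ne_zero_of_ne_bot hm0
  obtain ⟨p, hp, -⟩ := exists_heightOnePrime_mem hx0 ((IsLocalRing.mem_maximalIdeal x).1 hxm)
  have hpm : ¬ IsLocalRing.maximalIdeal R ≤ p := fun h ↦
    hm ((Ideal.height_mono h).trans (heightOnePrime_iff_height_le_one.1 hp).2.2)
  obtain ⟨y, hym, hyp⟩ := SetLike.not_le_iff_exists.1 hpm
  obtain ⟨q, hq, hyq⟩ := exists_heightOnePrime_mem (x := y) (by rintro rfl; exact hyp p.zero_mem)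
    ((IsLocalRing.mem_maximalIdeal y).1 hym)
  exact ⟨p, q, hp, hq, fun h ↦ hyp (h ▸ hyq)⟩

theorem HeightOnePrime.exists_mem_notMem {R : Type*} [CommRing R] [IsDomain R] {p q : Ideal R}
    (hp : HeightOnePrime p) (hq : HeightOnePrime q) (hpq : p ≠ q) : ∃ x ∈ p, x ∉ q := by
  refine SetLike.not_le_iff_exists.1 fun h ↦ hp.2.1 (hq.2.2 p hp.1 (lt_of_le_of_ne h hpq))

theorem Ring.ord_eq_zero_iff {R : Type*} [CommRing R] {x : R} : Ring.ord R x = 0 ↔ IsUnit x := by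
  rw [Ring.ord, Module.length_eq_zero_iff, Submodule.Quotient.subsingleton_iff,
    Ideal.span_singleton_eq_top]

open scoped nonZeroDivisors in
theorem HeightOnePrime.exists_order {R : Type*} (K : Type*) [CommRing R] [IsDomain R]
    [IsNoetherianRing R] [Field K] [Algebra R K] [IsFractionRing R K] {p : Ideal R}
    (hp : HeightOnePrime p) :
    ∃ v : K → ℤ, (∀ x y : K, x ≠ 0 → y ≠ 0 → v (x * y) = v x + v y) ∧
      ∀ r : R, r ≠ 0 → 0 ≤ v (algebraMap R K r) ∧ (v (algebraMap R K r) = 0 ↔ r ∉ p) := by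
  have := hp.1
  let A := Localization.AtPrime p
  have : IsDomain A := IsLocalization.isDomain_localization p.primeCompl_le_nonZeroDivisors
  have : IsNoetherianRing A := IsLocalization.isNoetherianRing p.primeCompl A inferInstance
  have : Ring.KrullDimLE 1 A := by
    rw [Ring.krullDimLE_iff, IsLocalization.AtPrime.ringKrullDim_eq_height p A]
    exact_mod_cast (heightOnePrime_iff_height_le_one.1 hp).2.2
  have hA {r : R} (hr : r ≠ 0) : algebraMap R A r ∈ A⁰ := by
    rw [mem_nonZeroDivisors_iff_ne_zero]
    exact fun h ↦ hr (IsLocalization.injective A p.primeCompl_le_nonZeroDivisors (by simpa using h))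
  let f : R →*₀ WithZero (Multiplicative ℤ) :=
    (Ring.ordMonoidWithZeroHom A).comp (algebraMap R A).toMonoidWithZeroHom
  have hf (r : R⁰) : IsUnit (f r) :=
    Ring.ordMonoidWithZeroHom_isUnit A ⟨_, hA (nonZeroDivisors.ne_zero r.2)⟩
  let g : K →*₀ WithZero (Multiplicative ℤ) :=
    (IsLocalization.toLocalizationMap R⁰ K).lift₀ f hf
  have hg (r : R) : g (algebraMap R K r) = f r := Submonoid.LocalizationMap.lift_eq ..
  refine ⟨fun x ↦ WithZero.log (g x), fun x y hx hy ↦ ?_, fun r hr ↦ ?_⟩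
  · simp only [map_mul]
    exact WithZero.log_mul ((map_ne_zero g).2 hx) ((map_ne_zero g).2 hy)
  · obtain ⟨n, hn⟩ := ENat.ne_top_iff_exists.1 (Ring.ord_ne_top (hA hr))
    have h : WithZero.log (g (algebraMap R K r)) = n := by
      rw [hg, show f r = _ from Ring.ordMonoidWithZeroHom_eq_coe A (hA hr) hn.symm]
      rfl
    have hu : n = 0 ↔ r ∉ p := by
      rw [← Nat.cast_inj (R := ℕ∞), hn, Nat.cast_zero, Ring.ord_eq_zero_iff,
        IsLocalization.AtPrime.isUnit_to_map_iff A p]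
      rfl
    simp only [h]
    exact ⟨by positivity, by exact_mod_cast hu⟩

/-- If two multiplicative functions that are non-negative on `R` are separated by some `β`, then
the V-topology axiom fails for `R`. -/
theorem not_exists_mul_mem_imp_of_separated {R K : Type*} [CommRing R] [IsDomain R] [Field K]
    [Algebra R K] [IsFractionRing R K] {v w : K → ℤ}
    (hv : ∀ x y : K, x ≠ 0 → y ≠ 0 → v (x * y) = v x + v y)
    (hw : ∀ x y : K, x ≠ 0 → y ≠ 0 → w (x * y) = w x + w y)
    (hvR : ∀ r : R, r ≠ 0 → 0 ≤ v (algebraMap R K r))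
    (hwR : ∀ r : R, r ≠ 0 → 0 ≤ w (algebraMap R K r))
    {β : K} (hβ : β ≠ 0) (hvβ : v β < 0) (hwβ : 0 < w β) :
    ¬ ∃ c : K, c ≠ 0 ∧ ∀ x y : K, x ≠ 0 → y ≠ 0 →
      (∃ r : R, x * y = c * algebraMap R K r) →
      (∃ r : R, x = algebraMap R K r) ∨ (∃ r : R, y = algebraMap R K r) := by
  rintro ⟨c, hc, H⟩
  have hpow {u : K → ℤ} (hu : ∀ x y : K, x ≠ 0 → y ≠ 0 → u (x * y) = u x + u y) (n : ℕ) :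
      u (β ^ (n + 1)) = (n + 1) * u β := by
    induction n with
    | zero => simp
    | succ n ih =>
      rw [pow_succ, hu _ _ (pow_ne_zero _ hβ) hβ, ih]
      push_cast
      ring
  have hnonneg {u : K → ℤ} (huR : ∀ r : R, r ≠ 0 → 0 ≤ u (algebraMap R K r)) {x : K} (hx : x ≠ 0)
      (h : ∃ r : R, x = algebraMap R K r) : 0 ≤ u x := by
    obtain ⟨r, rfl⟩ := h
    exact huR r fun h ↦ hx (by simp [h])
  let n := (w c).natAbs
  have hx : β ^ (n + 1) ≠ 0 := pow_ne_zero _ hβ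
  have hy : c / β ^ (n + 1) ≠ 0 := div_ne_zero hc hx
  have hxy : β ^ (n + 1) * (c / β ^ (n + 1)) = c := mul_div_cancel₀ _ hx
  rcases H _ _ hx hy ⟨1, by rw [hxy, map_one, mul_one]⟩ with h | h
  · have h1 := hnonneg hvR hx h
    rw [hpow hv] at h1
    nlinarith
  · have h1 := hnonneg hwR hy h
    have h2 := hw _ _ hx hy
    rw [hxy, hpow hw] at h2
    have h3 : w c ≤ n := Int.le_natAbs
    nlinarith


/-- A Noetherian local domain `R` of Krull dimension `≥ 2` has two distinct
height one primes `p ≠ p*`, and the associated order-of-vanishing homomorphisms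
`v, v* : Kˣ → ℤ` (non-negative on `R \ {0}`, positive exactly on the respective prime)
admit `β ∈ Kˣ` with `v β < 0 < v* β`; consequently the `R`-adic topology on
`K = Frac R` is not a V-topology (the V-topology axiom fails for `R`). -/
theorem stmt2 (R K : Type*) [CommRing R] [IsDomain R] [IsLocalRing R] (hR : ¬ IsField R)
    [IsNoetherianRing R] (hdim : 2 ≤ ringKrullDim R)
    [Field K] [Algebra R K] [IsFractionRing R K] :
    ∃ p pstar : Ideal R, HeightOnePrime p ∧ HeightOnePrime pstar ∧ p ≠ pstar ∧
    ∃ v vstar : K → ℤ,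
      (∀ x y : K, x ≠ 0 → y ≠ 0 → v (x * y) = v x + v y) ∧
      (∀ x y : K, x ≠ 0 → y ≠ 0 → vstar (x * y) = vstar x + vstar y) ∧
      (∀ r : R, r ≠ 0 → 0 ≤ v (algebraMap R K r) ∧ (v (algebraMap R K r) = 0 ↔ r ∉ p)) ∧
      (∀ r : R, r ≠ 0 →
        0 ≤ vstar (algebraMap R K r) ∧ (vstar (algebraMap R K r) = 0 ↔ r ∉ pstar)) ∧
      (∃ β : K, β ≠ 0 ∧ v β < 0 ∧ 0 < vstar β) ∧
      ¬ ∃ c : K, c ≠ 0 ∧ ∀ x y : K, x ≠ 0 → y ≠ 0 →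
          (∃ r : R, x * y = c * algebraMap R K r) →
          (∃ r : R, x = algebraMap R K r) ∨ (∃ r : R, y = algebraMap R K r) := by
  obtain ⟨p, q, hp, hq, hpq⟩ := exists_heightOnePrime_ne hdim
  obtain ⟨v, hv, hvR⟩ := hp.exists_order K
  obtain ⟨w, hw, hwR⟩ := hq.exists_order K
  obtain ⟨a, hap, haq⟩ := hp.exists_mem_notMem hq hpq
  obtain ⟨b, hbq, hbp⟩ := hq.exists_mem_notMem hp hpq.symm
  have ha : a ≠ 0 := fun h ↦ haq (h ▸ q.zero_mem)
  have hb : b ≠ 0 := fun h ↦ hbp (h ▸ p.zero_mem)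
  have ha' : algebraMap R K a ≠ 0 := by simpa using ha
  have hb' : algebraMap R K b ≠ 0 := by simpa using hb
  have hβ : algebraMap R K b / algebraMap R K a ≠ 0 := div_ne_zero hb' ha'
  have hmul : algebraMap R K b / algebraMap R K a * algebraMap R K a = algebraMap R K b :=
    div_mul_cancel₀ _ ha'
  have hvβ : v (algebraMap R K b / algebraMap R K a) < 0 := by
    have h := hv _ _ hβ ha'
    rw [hmul, (hvR b hb).2.2 hbp] at h
    have := lt_of_le_of_ne (hvR a ha).1 fun h0 ↦ (hvR a ha).2.1 h0.symm hap
    lia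
  have hwβ : 0 < w (algebraMap R K b / algebraMap R K a) := by
    have h := hw _ _ hβ ha'
    rw [hmul, (hwR a ha).2.2 haq] at h
    have := lt_of_le_of_ne (hwR b hb).1 fun h0 ↦ (hwR b hb).2.1 h0.symm hbq
    lia
  exact ⟨p, q, hp, hq, hpq, v, w, hv, hw, hvR, hwR, ⟨_, hβ, hvβ, hwβ⟩,
    not_exists_mul_mem_imp_of_separated hv hw (fun r hr ↦ (hvR r hr).1) (fun r hr ↦ (hwR r hr).1)
      hβ hvβ hwβ⟩
end

section
/- Let R be a Henselian regular local ring of dimension ≥ 2 with fraction field K and maximal ideal m, with residue characteristic ≠ 2. If α, β ∈ K satisfy 1 + α⁴ = β², then α ∈ R or 1/α ∈ R. -/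
/-- A regular local ring: Noetherian local ring whose maximal ideal is generated by
`dim R` elements. -/
def IsRegularLocal (R : Type*) [CommRing R] [IsLocalRing R] : Prop :=
  IsNoetherianRing R ∧ ∃ s : Finset R, Ideal.span (s : Set R) = IsLocalRing.maximalIdeal R ∧
    (s.card : WithBot (WithTop ℕ)) = ringKrullDim R

universe u

open IsLocalRing Polynomial in
theorem AdjoinRoot.formallyUnramified_X_sq_sub_C {R : Type*} [CommRing R] (h2 : IsUnit (2 : R))
    (u : R) (hu : IsUnit u) : Algebra.FormallyUnramified R (AdjoinRoot (X ^ 2 - C u)) := by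
  rw [Algebra.FormallyUnramified.iff_comp_injective]
  intro B _ _ I hI f g hfg
  have key (f : AdjoinRoot (X ^ 2 - C u) →ₐ[R] B) :
      f (AdjoinRoot.root _) ^ 2 = algebraMap R B u := by
    have := AdjoinRoot.eval₂_root (X ^ 2 - C u)
    simp only [eval₂_sub, eval₂_pow, eval₂_X, eval₂_C, sub_eq_zero] at this
    rw [← map_pow, this]
    exact f.commutes u
  apply AdjoinRoot.algHom_ext
  set a := f (AdjoinRoot.root _) with ha
  set b := g (AdjoinRoot.root _) with hb
  have ha2 : a ^ 2 = algebraMap R B u := key f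
  have hb2 : b ^ 2 = algebraMap R B u := key g
  have hab : a - b ∈ I := by
    rw [← Ideal.Quotient.eq]
    exact DFunLike.congr_fun hfg (AdjoinRoot.root _)
  have hsq : (a - b) ^ 2 = 0 := by
    have := Ideal.pow_mem_pow hab 2
    rwa [hI] at this
  have hau : IsUnit a := by
    rw [← isUnit_pow_iff two_ne_zero, ha2]
    exact hu.map _
  have h2B : IsUnit (2 : B) := by
    simpa only [map_ofNat] using h2.map (algebraMap R B)
  have : (a - b) * (2 * a) = 0 := by linear_combination hsq + ha2 - hb2
  exact sub_eq_zero.mp ((h2B.mul hau).mul_left_eq_zero.mp this)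

open IsLocalRing Polynomial in
/-- Over a local ring in which `2` is invertible, the square root of a unit can be adjoined by a
faithfully flat unramified local extension. -/
theorem exists_flat_local_extension_sq_eq {R : Type u} [CommRing R] [IsDomain R] [IsLocalRing R]
    [IsNoetherianRing R] (h2 : IsUnit (2 : R)) (u : R) (hu : IsUnit u) :
    ∃ (S : Type u) (_ : CommRing S) (_ : IsLocalRing S) (_ : IsNoetherianRing S) (_ : Algebra R S),
      Module.FaithfullyFlat R S ∧
      (maximalIdeal R).map (algebraMap R S) = maximalIdeal S ∧
      ∃ v : S, v ^ 2 = algebraMap R S u := by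
  have hm : (X ^ 2 - C u).Monic := monic_X_pow_sub_C u two_ne_zero
  let A := AdjoinRoot (X ^ 2 - C u)
  have : Module.Free R A := hm.free_adjoinRoot
  have : Module.Finite R A := hm.finite_adjoinRoot
  have : Nontrivial A := AdjoinRoot.nontrivial _ (by
    rw [degree_X_pow_sub_C two_pos]; decide)
  have : FaithfulSMul R A := inferInstance
  have : IsNoetherianRing A := IsNoetherianRing.of_finite R A
  obtain ⟨q, -, hq, hqm⟩ := Ideal.exists_ideal_over_prime_of_isIntegral (S := A) (maximalIdeal R) ⊥
    (by
      rw [← RingHom.ker_eq_comap_bot, (RingHom.injective_iff_ker_eq_bot _).mp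
        (FaithfulSMul.algebraMap_injective R A)]
      exact bot_le)
  have : Algebra.FormallyUnramified R A := AdjoinRoot.formallyUnramified_X_sq_sub_C h2 u hu
  let S := Localization.AtPrime q
  have : Algebra.FormallyUnramified A S := .of_isLocalization q.primeCompl
  have : Algebra.FormallyUnramified R S := .comp R A S
  have : Module.Flat A S := IsLocalization.flat S q.primeCompl
  have : Module.Flat R S := Module.Flat.trans R A S
  have : Algebra.EssFiniteType A S := .of_isLocalization S q.primeCompl
  have : Algebra.EssFiniteType R S := .comp R A S
  have hloc : IsLocalHom (algebraMap R S) := by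
    refine ((local_hom_TFAE (algebraMap R S)).out 0 4).mpr ?_
    rw [IsScalarTower.algebraMap_eq R A S, ← Ideal.comap_comap, ← Ideal.under_def A,
      IsLocalization.AtPrime.under_maximalIdeal S q]
    exact hqm
  refine ⟨S, inferInstance, inferInstance, IsLocalization.isNoetherianRing q.primeCompl S ‹_›,
    inferInstance, Module.FaithfullyFlat.of_flat_of_isLocalHom,
    Algebra.FormallyUnramified.map_maximalIdeal, algebraMap A S (AdjoinRoot.root _), ?_⟩
  have := AdjoinRoot.eval₂_root (X ^ 2 - C u)
  simp only [eval₂_sub, eval₂_pow, eval₂_X, eval₂_C, sub_eq_zero] at this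
  rw [← map_pow, this, IsScalarTower.algebraMap_apply R A S]
  rfl

open IsLocalRing RingTheory.Sequence

theorem isWeaklyRegular_pair_iff {R : Type*} [CommRing R] {x y : R} :
    IsWeaklyRegular R [x, y] ↔
      (∀ r, x * r = 0 → r = 0) ∧ ∀ r, x ∣ y * r → x ∣ r := by
  rw [isWeaklyRegular_cons_iff, isWeaklyRegular_cons_iff]
  refine and_congr ?_ ?_
  · rw [isSMulRegular_iff_right_eq_zero_of_smul]
    rfl
  · simp only [IsWeaklyRegular.nil, and_true]
    rw [isSMulRegular_quotient_iff_mem_of_smul_mem]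
    simp [Submodule.mem_smul_pointwise_iff_exists, Dvd.dvd, eq_comm]

/-- In a Noetherian local ring, a prime contained in a principal ideal whose generator it avoids
is zero. -/
theorem Ideal.IsPrime.eq_bot_of_le_span_singleton {R : Type*} [CommRing R] [IsLocalRing R]
    [IsNoetherianRing R] {p : Ideal R} (hp : p.IsPrime) {x : R} (hx : x ∈ maximalIdeal R)
    (hle : p ≤ Ideal.span {x}) (hxp : x ∉ p) : p = ⊥ := by
  refine Submodule.eq_bot_of_le_smul_of_le_jacobson_bot (Ideal.span {x}) p
    p.fg_of_isNoetherianRing (fun z hz => ?_) ?_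
  · obtain ⟨w, rfl⟩ := Ideal.mem_span_singleton.mp (hle hz)
    exact Ideal.mul_mem_mul (Ideal.mem_span_singleton_self x)
      ((hp.mem_or_mem hz).resolve_left hxp)
  · rw [IsLocalRing.jacobson_eq_maximalIdeal _ bot_ne_top, Ideal.span_singleton_le_iff_mem]
    exact hx

theorem IsDomain.of_isPrime_span_singleton {R : Type*} [CommRing R] [IsLocalRing R]
    [IsNoetherianRing R] {x : R} (hx : x ∈ maximalIdeal R) (hreg : ∀ r, x * r = 0 → r = 0)
    (hprime : (Ideal.span {x}).IsPrime) : IsDomain R := by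
  obtain ⟨p, hp, hle⟩ := Ideal.exists_minimalPrimes_le (I := (⊥ : Ideal R))
    (J := Ideal.span {x}) bot_le
  have hpp : p.IsPrime := hp.1.1
  have hxp : x ∉ p := fun h => Set.disjoint_left.mp
    (Ideal.disjoint_nonZeroDivisors_of_mem_minimalPrimes hp) h
    (mem_nonZeroDivisors_iff_left.mpr hreg)
  have := hpp.eq_bot_of_le_span_singleton hx hle hxp
  subst this
  exact IsDomain.of_bot_isPrime R

/-- A local ring whose maximal ideal is generated by a regular sequence of length two. -/
def IsLocalRing.HasRegularPair (R : Type*) [CommRing R] [IsLocalRing R] : Prop :=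
  ∃ x y : R, maximalIdeal R = Ideal.span {x, y} ∧ IsWeaklyRegular R [x, y]

namespace IsLocalRing.HasRegularPair

theorem of_faithfullyFlat {R S : Type*} [CommRing R] [IsLocalRing R] [CommRing S] [IsLocalRing S]
    [Algebra R S] [Module.FaithfullyFlat R S]
    (hm : (maximalIdeal R).map (algebraMap R S) = maximalIdeal S)
    (h : HasRegularPair R) : HasRegularPair S := by
  obtain ⟨x, y, hxy, hreg⟩ := h
  refine ⟨algebraMap R S x, algebraMap R S y, ?_, hreg.of_flat (S := S)⟩
  rw [← hm, hxy, Ideal.map_span, Set.image_pair]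

theorem exists_isPrincipalIdealRing_quotient {R : Type*} [CommRing R] [IsLocalRing R]
    [IsNoetherianRing R] (h : HasRegularPair R) :
    ∃ x ∈ maximalIdeal R, (∀ r, x * r = 0 → r = 0) ∧ (Ideal.span {x}).IsPrime ∧
      IsPrincipalIdealRing (R ⧸ Ideal.span {x}) := by
  obtain ⟨x, y, hxy, hreg⟩ := h
  obtain ⟨hx, hy⟩ := isWeaklyRegular_pair_iff.mp hreg
  have hxm : x ∈ maximalIdeal R := hxy ▸ Ideal.subset_span (by simp)
  have hym : y ∈ maximalIdeal R := hxy ▸ Ideal.subset_span (by simp)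
  have hne : Ideal.span {x} ≠ ⊤ := fun h => by
    rw [Ideal.span_singleton_eq_top] at h
    exact hxm h
  have : Nontrivial (R ⧸ Ideal.span {x}) := Ideal.Quotient.nontrivial_iff.mpr hne
  have : IsLocalRing (R ⧸ Ideal.span {x}) :=
    .of_surjective' _ Ideal.Quotient.mk_surjective
  have hmax : maximalIdeal (R ⧸ Ideal.span {x}) =
      Ideal.span {Ideal.Quotient.mk (Ideal.span {x}) y} := by
    rw [← IsLocalRing.map_maximalIdeal_of_surjective (Ideal.Quotient.mk (Ideal.span {x}))
      Ideal.Quotient.mk_surjective, hxy, Ideal.map_span, Set.image_pair]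
    rw [Ideal.Quotient.eq_zero_iff_mem.mpr (Ideal.mem_span_singleton_self x), Ideal.span_insert_zero]
  have hdom : IsDomain (R ⧸ Ideal.span {x}) := by
    refine IsDomain.of_isPrime_span_singleton (x := Ideal.Quotient.mk _ y)
      (hmax ▸ Ideal.mem_span_singleton_self _) (fun r hr => ?_)
      (hmax ▸ (maximalIdeal.isMaximal _).isPrime)
    obtain ⟨r, rfl⟩ := Ideal.Quotient.mk_surjective r
    rw [← map_mul, Ideal.Quotient.eq_zero_iff_dvd] at hr
    exact Ideal.Quotient.eq_zero_iff_dvd _ _ |>.mpr (hy r hr)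
  refine ⟨x, hxm, hx, (Ideal.Quotient.isDomain_iff_prime _).mp hdom, ?_⟩
  have hprin : (maximalIdeal (R ⧸ Ideal.span {x})).IsPrincipal := ⟨⟨_, hmax⟩⟩
  exact ((tfae_of_isNoetherianRing_of_isLocalRing_of_isDomain _).out 0 4 rfl rfl).mpr hprin

theorem isDomain {R : Type*} [CommRing R] [IsLocalRing R] [IsNoetherianRing R]
    (h : HasRegularPair R) : IsDomain R := by
  obtain ⟨x, hxm, hx, hp, -⟩ := h.exists_isPrincipalIdealRing_quotient
  exact IsDomain.of_isPrime_span_singleton hxm hx hp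

theorem uniqueFactorizationMonoid {R : Type*} [CommRing R] [IsDomain R] [IsLocalRing R]
    [IsNoetherianRing R] (h : HasRegularPair R) : UniqueFactorizationMonoid R := by
  obtain ⟨x, hxm, hx, hprime, hpir⟩ := h.exists_isPrincipalIdealRing_quotient
  have hx0 : x ≠ 0 := fun h0 => one_ne_zero (hx 1 (by simp [h0]))
  refine UniqueFactorizationMonoid.iff_exists_prime_mem_of_isPrime.mpr fun p hp0 hp => ?_
  by_cases hxp : x ∈ p
  · exact ⟨x, hxp, (Ideal.span_singleton_prime hx0).mp hprime⟩
  obtain ⟨g, hg⟩ := (hpir.principal (p.map (Ideal.Quotient.mk (Ideal.span {x})))).principal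
  have hgm : g ∈ p.map (Ideal.Quotient.mk (Ideal.span {x})) :=
    hg ▸ Submodule.mem_span_singleton_self g
  obtain ⟨f, hf, rfl⟩ := (Ideal.mem_map_iff_of_surjective _ Ideal.Quotient.mk_surjective).mp hgm
  have hle : p ≤ Ideal.span {f} := by
    refine Submodule.le_of_le_smul_of_le_jacobson_bot (I := Ideal.span {x})
      p.fg_of_isNoetherianRing ?_ fun z hz => ?_
    · rw [IsLocalRing.jacobson_eq_maximalIdeal _ bot_ne_top, Ideal.span_singleton_le_iff_mem]
      exact hxm
    have hz' : Ideal.Quotient.mk (Ideal.span {x}) z ∈ Ideal.span {Ideal.Quotient.mk _ f} :=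
      hg.le (Ideal.mem_map_of_mem _ hz)
    obtain ⟨r, hr⟩ := Ideal.mem_span_singleton.mp hz'
    obtain ⟨r, rfl⟩ := Ideal.Quotient.mk_surjective r
    rw [← map_mul, Ideal.Quotient.eq, Ideal.mem_span_singleton] at hr
    obtain ⟨w, hw⟩ := hr
    have hwp : w ∈ p := by
      refine (hp.mem_or_mem (?_ : x * w ∈ p)).resolve_left hxp
      rw [← hw]
      exact p.sub_mem hz (p.mul_mem_right _ hf)
    rw [show z = f * r + x * w by rw [← hw]; ring]
    exact Submodule.add_mem_sup (Ideal.mul_mem_right _ _ (Ideal.mem_span_singleton_self f))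
      (Ideal.mul_mem_mul (Ideal.mem_span_singleton_self x) hwp)
  have heq : p = Ideal.span {f} :=
    le_antisymm hle ((Ideal.span_singleton_le_iff_mem _).mpr hf)
  have hf0 : f ≠ 0 := by
    rintro rfl
    exact hp0 (by simpa using heq)
  exact ⟨f, hf, (Ideal.span_singleton_prime hf0).mp (heq ▸ hp)⟩

end IsLocalRing.HasRegularPair

theorem isRelPrime_of_dvd_of_dvd_mul {R : Type*} [CommRing R] [IsDomain R] {p q : R} (hp : p ≠ 0)
    (h : ∀ r, p ∣ q * r → p ∣ r) : IsRelPrime p q := by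
  rintro d ⟨p', hp'⟩ ⟨q', hq'⟩
  obtain ⟨e, he⟩ := h p' ⟨q', by rw [hq', hp']; ring⟩
  have hp'0 : p' ≠ 0 := by
    rintro rfl
    simp [hp'] at hp
  refine IsUnit.of_mul_eq_one e (mul_left_cancel₀ hp'0 ?_)
  linear_combination (-1 : R) * he - e * hp'

theorem IsRelPrime.map_of_flat {R S : Type*} [CommRing R] [IsDomain R]
    [UniqueFactorizationMonoid R] [CommRing S] [IsDomain S] [Algebra R S] [Module.FaithfullyFlat R S]
    {p q : R} (h : IsRelPrime p q) : IsRelPrime (algebraMap R S p) (algebraMap R S q) := by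
  by_cases hp : p = 0
  · subst hp
    exact ((isRelPrime_zero_left.mp h).map (algebraMap R S)).isRelPrime_right
  have : IsWeaklyRegular R [p, q] := isWeaklyRegular_pair_iff.mpr
    ⟨fun r hr => (mul_eq_zero.mp hr).resolve_left hp, fun r hr => h.dvd_of_dvd_mul_left hr⟩
  exact isRelPrime_of_dvd_of_dvd_mul
    (by simpa using (FaithfulSMul.algebraMap_injective R S).ne hp)
    (isWeaklyRegular_pair_iff.mp (this.of_flat (S := S))).2

theorem UniqueFactorizationMonoid.exists_eq_isUnit_mul_pow {R : Type*} [CommRing R] [IsDomain R]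
    [UniqueFactorizationMonoid R] {x y a z : R} {k : ℕ} (h : IsRelPrime x y) (ha : IsUnit a)
    (hz : a * (x * y) = z ^ k) : ∃ v d, IsUnit v ∧ x = v * d ^ k := by
  let _ := UniqueFactorizationMonoid.toGCDMonoid R
  obtain ⟨a, rfl⟩ := ha
  have hg : IsUnit (gcd x ((a : R) * y)) := by
    rw [gcd_isUnit_iff_isRelPrime]
    exact (isRelPrime_mul_unit_left_right a.isUnit).mpr h
  obtain ⟨d, w, hd⟩ := exists_associated_pow_of_mul_eq_pow (c := z) (k := k) hg
    (by rw [← hz]; ring)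
  exact ⟨w, d, w.isUnit, by rw [← hd]; ring⟩

/-- A square root of a unit can be adjoined to a local ring with a regular pair of parameters and
`2` invertible, preserving relative primality and the filtration by powers of the maximal ideal. -/
theorem IsLocalRing.HasRegularPair.exists_ringHom_sq_eq {R : Type u} [CommRing R] [IsDomain R]
    [IsLocalRing R] [IsNoetherianRing R] (h : HasRegularPair R) (h2 : IsUnit (2 : R))
    {u : R} (hu : IsUnit u) :
    ∃ (S : Type u) (_ : CommRing S) (_ : IsDomain S) (_ : IsLocalRing S) (_ : IsNoetherianRing S)
      (f : R →+* S), HasRegularPair S ∧ (∀ p q, IsRelPrime p q → IsRelPrime (f p) (f q)) ∧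
      (∀ n z, f z ∈ maximalIdeal S ^ n ↔ z ∈ maximalIdeal R ^ n) ∧ ∃ v, v ^ 2 = f u := by
  obtain ⟨S, _, _, _, _, _, hm, hv⟩ := exists_flat_local_extension_sq_eq h2 u hu
  have hS := h.of_faithfullyFlat hm
  have hd := hS.isDomain
  have := h.uniqueFactorizationMonoid
  refine ⟨S, _, hd, _, ‹_›, algebraMap R S, hS, fun p q hpq => hpq.map_of_flat, fun n z => ?_, hv⟩
  rw [← hm, ← Ideal.map_pow, ← Ideal.mem_comap, Ideal.comap_map_eq_self_of_faithfullyFlat]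

theorem IsLocalRing.mem_pow_maximalIdeal_of_forms_eq_sq (k : ℕ) {R : Type u} [CommRing R]
    [IsDomain R] [IsLocalRing R] [IsNoetherianRing R] (hR : HasRegularPair R)
    (h2 : IsUnit (2 : R)) {p q r s a b c d : R} (ha : IsUnit a) (hb : IsUnit b) (hc : IsUnit c)
    (hd : IsUnit d) (hdet : IsUnit (a * d - b * c)) (hp : p ∈ maximalIdeal R)
    (hq : q ∈ maximalIdeal R) (hpq : IsRelPrime p q) (hr : r ^ 2 = a * p ^ 2 + b * q ^ 2)
    (hs : s ^ 2 = c * p ^ 2 + d * q ^ 2) :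
    p ∈ maximalIdeal R ^ (2 ^ k) ∧ q ∈ maximalIdeal R ^ (2 ^ k) := by
  induction k generalizing R with
  | zero => simpa using ⟨hp, hq⟩
  | succ k ih =>
    obtain ⟨a', haa'⟩ := ha.exists_right_inv
    obtain ⟨c', hcc'⟩ := hc.exists_right_inv
    have ha' : IsUnit a' := IsUnit.of_mul_eq_one_right a haa'
    have hc' : IsUnit c' := IsUnit.of_mul_eq_one_right c hcc'
    obtain ⟨S₁, _, _, _, _, f, hS₁, hf, hfm, l₁, hl₁⟩ :=
      hR.exists_ringHom_sq_eq h2 (u := -b * a') (hb.neg.mul ha')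
    obtain ⟨S, _, _, _, _, g, hS, hg, hgm, m, hm⟩ :=
      hS₁.exists_ringHom_sq_eq (by simpa only [map_ofNat] using h2.map f)
        (u := f (-d * c')) ((hd.neg.mul hc').map f)
    obtain ⟨F, hF⟩ : ∃ F : R →+* S, F = g.comp f := ⟨_, rfl⟩
    have hFrel : IsRelPrime (F p) (F q) := by rw [hF]; exact hg _ _ (hf _ _ hpq)
    have hFm (n : ℕ) (z : R) : F z ∈ maximalIdeal S ^ n ↔ z ∈ maximalIdeal R ^ n := by
      rw [hF]; exact (hgm _ _).trans (hfm _ _)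
    have hl : g l₁ ^ 2 = F (-b * a') := by rw [← map_pow, hl₁, hF]; rfl
    have hm : m ^ 2 = F (-d * c') := by rw [hm, hF]; rfl
    generalize g l₁ = l at hl
    have hu2 : IsUnit (2 : S) := by simpa only [map_ofNat] using h2.map F
    have hul : IsUnit l := by
      rw [← isUnit_pow_iff two_ne_zero, hl]
      exact (hb.neg.mul ha').map F
    have hum : IsUnit m := by
      rw [← isUnit_pow_iff two_ne_zero, hm]
      exact (hd.neg.mul hc').map F
    have hul2 : F a * l ^ 2 = - F b := by
      rw [hl, ← map_mul, ← map_neg]; congr 1; linear_combination (-b) * haa'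
    have hum2 : F c * m ^ 2 = - F d := by
      rw [hm, ← map_mul, ← map_neg]; congr 1; linear_combination (-d) * hcc'
    have hFa := ha.map F
    have hFc := hc.map F
    have hFr : F r ^ 2 = F a * F p ^ 2 + F b * F q ^ 2 := by
      simp only [← map_pow, hr, map_add, map_mul]
    have hFs : F s ^ 2 = F c * F p ^ 2 + F d * F q ^ 2 := by
      simp only [← map_pow, hs, map_add, map_mul]
    have hFdet : IsUnit (F a * F d - F b * F c) := by
      simpa only [map_sub, map_mul] using hdet.map F
    have hFp : F p ∈ maximalIdeal S := by simpa using (hFm 1 p).mpr (by simpa using hp)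
    have hFq : F q ∈ maximalIdeal S := by simpa using (hFm 1 q).mpr (by simpa using hq)
    rw [← hFm, ← hFm]
    generalize F p = p at *
    generalize F q = q at *
    generalize F r = r at *
    generalize F s = s at *
    generalize F a = a at *
    generalize F b = b at *
    generalize F c = c at *
    generalize F d = d at *
    clear hm hl hF hFm F ha hb hc hd
    have := hS.uniqueFactorizationMonoid
    have hrel (l : S) (hul : IsUnit l) : IsRelPrime (p - l * q) (p + l * q) := by
      intro e he₁ he₂
      refine hFrel ?_ ?_
      · rw [← hu2.dvd_mul_left]
        convert dvd_add he₁ he₂ using 1; ring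
      · rw [← (hu2.mul hul).dvd_mul_left]
        convert dvd_sub he₂ he₁ using 1; ring
    obtain ⟨v₁, P, hv₁, hP⟩ := UniqueFactorizationMonoid.exists_eq_isUnit_mul_pow (z := r) (k := 2)
      (hrel l hul) hFa (by linear_combination -hFr - q ^ 2 * hul2)
    obtain ⟨v₂, Q, hv₂, hQ⟩ := UniqueFactorizationMonoid.exists_eq_isUnit_mul_pow (z := r) (k := 2)
      (hrel l hul).symm hFa (by linear_combination -hFr - q ^ 2 * hul2)
    obtain ⟨v₃, T, hv₃, hT⟩ := UniqueFactorizationMonoid.exists_eq_isUnit_mul_pow (z := s) (k := 2)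
      (hrel m hum) hFc (by linear_combination -hFs - q ^ 2 * hum2)
    obtain ⟨v₄, W, hv₄, hW⟩ := UniqueFactorizationMonoid.exists_eq_isUnit_mul_pow (z := s) (k := 2)
      (hrel m hum).symm hFc (by linear_combination -hFs - q ^ 2 * hum2)
    obtain ⟨i2, hi2⟩ := hu2.exists_right_inv
    obtain ⟨li, hli⟩ := hul.exists_right_inv
    obtain ⟨w₃, hw₃⟩ := hv₃.exists_right_inv
    obtain ⟨w₄, hw₄⟩ := hv₄.exists_right_inv
    have hi2u : IsUnit i2 := IsUnit.of_mul_eq_one_right _ hi2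
    have hliu : IsUnit li := IsUnit.of_mul_eq_one_right _ hli
    have hw₃u : IsUnit w₃ := IsUnit.of_mul_eq_one_right _ hw₃
    have hw₄u : IsUnit w₄ := IsUnit.of_mul_eq_one_right _ hw₄
    have hlm : IsUnit ((l + m) * (l - m)) := by
      refine isUnit_of_mul_isUnit_right (x := a * c) ?_
      convert hFdet using 1
      linear_combination c * hul2 - a * hum2
    have hlm₁ := isUnit_of_mul_isUnit_left hlm
    have hlm₂ := isUnit_of_mul_isUnit_right hlm
    have hPm : v₁ * P ^ 2 ∈ maximalIdeal S := hP ▸ Ideal.sub_mem _ hFp (Ideal.mul_mem_left _ _ hFq)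
    have hQm : v₂ * Q ^ 2 ∈ maximalIdeal S := hQ ▸ Ideal.add_mem _ hFp (Ideal.mul_mem_left _ _ hFq)
    have hmem {v P : S} (hv : IsUnit v) (h : v * P ^ 2 ∈ maximalIdeal S) : P ∈ maximalIdeal S :=
      (maximalIdeal.isMaximal S).isPrime.mem_of_pow_mem 2
        ((Ideal.unit_mul_mem_iff_mem _ hv).mp h)
    have hPQ : IsRelPrime P Q := by
      intro e he₁ he₂
      refine hrel l hul ?_ ?_
      · rw [hP]; exact (dvd_pow he₁ two_ne_zero).mul_left _
      · rw [hQ]; exact (dvd_pow he₂ two_ne_zero).mul_left _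
    have hp2 : p = i2 * (v₁ * P ^ 2 + v₂ * Q ^ 2) := by
      linear_combination (-p) * hi2 + i2 * hP + i2 * hQ
    have hq2 : q = i2 * li * (v₂ * Q ^ 2 - v₁ * P ^ 2) := by
      linear_combination (-q) * hi2 - 2 * i2 * q * hli + i2 * li * (hQ - hP)
    obtain ⟨h₁, h₂⟩ := ih (R := S) hS hu2 (p := P) (q := Q) (r := T) (s := W)
      (a := w₃ * (i2 * li * v₁ * (l + m))) (b := w₃ * (i2 * li * v₂ * (l - m)))
      (c := w₄ * (i2 * li * v₁ * (l - m))) (d := w₄ * (i2 * li * v₂ * (l + m)))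
      (by simp [*]) (by simp [*]) (by simp [*]) (by simp [*])
      (by
        have : IsUnit (w₃ * w₄ * i2 * i2 * li * li * v₁ * v₂ * (2 * 2 * l * m)) := by simp [*]
        convert this using 1; ring)
      (hmem hv₁ hPm) (hmem hv₂ hQm) hPQ
      (by
        linear_combination (-T ^ 2) * hw₃ - w₃ * hT + w₃ * hp2 - w₃ * m * hq2 -
          w₃ * i2 * (v₁ * P ^ 2 + v₂ * Q ^ 2) * hli)
      (by
        linear_combination (-W ^ 2) * hw₄ - w₄ * hW + w₄ * hp2 + w₄ * m * hq2 -
          w₄ * i2 * (v₁ * P ^ 2 + v₂ * Q ^ 2) * hli)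
    have hsq {v P : S} (h : P ∈ maximalIdeal S ^ 2 ^ k) :
        v * P ^ 2 ∈ maximalIdeal S ^ 2 ^ (k + 1) := by
      refine Ideal.mul_mem_left _ _ ?_
      rw [pow_succ, pow_mul]
      exact Ideal.pow_mem_pow h 2
    rw [hp2, hq2]
    exact ⟨Ideal.mul_mem_left _ _ (add_mem (hsq h₁) (hsq h₂)),
      Ideal.mul_mem_left _ _ (sub_mem (hsq h₂) (hsq h₁))⟩

/-- In a two-dimensional regular local ring with `2` invertible, two relatively prime nonunits
never have a square as sum of their fourth powers. -/
theorem IsLocalRing.HasRegularPair.pow_four_add_pow_four_ne_sq {R : Type u} [CommRing R]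
    [IsDomain R] [IsLocalRing R] [IsNoetherianRing R] (hR : HasRegularPair R)
    (h2 : IsUnit (2 : R)) {a b c : R} (ha : a ∈ maximalIdeal R) (hb : b ∈ maximalIdeal R)
    (hab : IsRelPrime a b) : b ^ 4 + a ^ 4 ≠ c ^ 2 := by
  intro h
  have := hR.uniqueFactorizationMonoid
  have hm := (maximalIdeal.isMaximal R).isPrime
  have hc : c ∈ maximalIdeal R := hm.mem_of_pow_mem 2
    (h ▸ Ideal.add_mem _ (Ideal.pow_mem_of_mem _ hb 4 (by simp))
      (Ideal.pow_mem_of_mem _ ha 4 (by simp)))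
  have ha2 : a ^ 2 ∈ maximalIdeal R := Ideal.pow_mem_of_mem _ ha 2 (by simp)
  have hrel : IsRelPrime (c - a ^ 2) (c + a ^ 2) := by
    intro e he₁ he₂
    refine hab.pow (m := 2) (n := 4) ?_ ?_
    · rw [← h2.dvd_mul_left]
      convert dvd_sub he₂ he₁ using 1; ring
    · convert he₁.mul_right (c + a ^ 2) using 1; linear_combination h
  obtain ⟨u₁, e, hu₁, he⟩ := UniqueFactorizationMonoid.exists_eq_isUnit_mul_pow (z := b) (k := 4)
    hrel isUnit_one (by linear_combination -h)
  obtain ⟨u₂, f, hu₂, hf⟩ := UniqueFactorizationMonoid.exists_eq_isUnit_mul_pow (z := b) (k := 4)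
    hrel.symm isUnit_one (by linear_combination -h)
  have hmem {v e : R} (hv : IsUnit v) (h : v * e ^ 4 ∈ maximalIdeal R) : e ∈ maximalIdeal R :=
    hm.mem_of_pow_mem 4 ((Ideal.unit_mul_mem_iff_mem _ hv).mp h)
  have hem : e ∈ maximalIdeal R := hmem hu₁ (he ▸ sub_mem hc ha2)
  have hfm : f ∈ maximalIdeal R := hmem hu₂ (hf ▸ add_mem hc ha2)
  have hfe : IsRelPrime f e := by
    intro d h₁ h₂
    refine hrel ?_ ?_
    · rw [he]; exact (dvd_pow h₂ four_ne_zero).mul_left _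
    · rw [hf]; exact (dvd_pow h₁ four_ne_zero).mul_left _
  have h2a : 2 * a ^ 2 = u₂ * f ^ 4 - u₁ * e ^ 4 := by linear_combination hf - he
  obtain ⟨w₂, hw₂⟩ := hu₂.exists_right_inv
  have hw₂u : IsUnit w₂ := IsUnit.of_mul_eq_one_right _ hw₂
  obtain ⟨S, _, _, _, _, F, hS, hF, hFm, l, hl⟩ := hR.exists_ringHom_sq_eq h2 (hu₁.mul hw₂u)
  have := hS.uniqueFactorizationMonoid
  have hu2 : IsUnit (2 : S) := by simpa only [map_ofNat] using h2.map F
  have hul : IsUnit l := by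
    rw [← isUnit_pow_iff two_ne_zero, hl]
    exact (hu₁.mul hw₂u).map F
  have hFfe := hF _ _ hfe
  have hl' : F u₂ * l ^ 2 = F u₁ := by
    rw [hl, ← map_mul]; congr 1; linear_combination u₁ * hw₂
  have hFa : 2 * F a ^ 2 = F u₂ * F f ^ 4 - F u₁ * F e ^ 4 := by
    simpa only [map_mul, map_sub, map_pow, map_ofNat] using congrArg F h2a
  have hrel' : IsRelPrime (F f ^ 2 - l * F e ^ 2) (F f ^ 2 + l * F e ^ 2) := by
    intro d h₁ h₂
    refine hFfe.pow (m := 2) (n := 2) ?_ ?_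
    · rw [← hu2.dvd_mul_left]
      convert dvd_add h₁ h₂ using 1; ring
    · rw [← (hu2.mul hul).dvd_mul_left]
      convert dvd_sub h₂ h₁ using 1; ring
  obtain ⟨i2, hi2⟩ := hu2.exists_right_inv
  have hi2u : IsUnit i2 := IsUnit.of_mul_eq_one_right _ hi2
  have hunit := hi2u.mul (hu₂.map F)
  have hprod : i2 * F u₂ *
      ((F f ^ 2 - l * F e ^ 2) * (F f ^ 2 + l * F e ^ 2)) = F a ^ 2 := by
    linear_combination -i2 * hFa + F a ^ 2 * hi2 - i2 * F e ^ 4 * hl'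
  obtain ⟨v₃, r, hv₃, hr⟩ := UniqueFactorizationMonoid.exists_eq_isUnit_mul_pow (z := F a) (k := 2)
    hrel' hunit hprod
  obtain ⟨v₄, s, hv₄, hs⟩ := UniqueFactorizationMonoid.exists_eq_isUnit_mul_pow (z := F a) (k := 2)
    hrel'.symm hunit (by rw [← hprod]; ring)
  obtain ⟨w₃, hw₃⟩ := hv₃.exists_right_inv
  obtain ⟨w₄, hw₄⟩ := hv₄.exists_right_inv
  have hw₃u : IsUnit w₃ := IsUnit.of_mul_eq_one_right _ hw₃
  have hw₄u : IsUnit w₄ := IsUnit.of_mul_eq_one_right _ hw₄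
  have hFem : F e ∈ maximalIdeal S := by simpa using (hFm 1 e).mpr (by simpa using hem)
  have hFfm : F f ∈ maximalIdeal S := by simpa using (hFm 1 f).mpr (by simpa using hfm)
  have key (k : ℕ) := IsLocalRing.mem_pow_maximalIdeal_of_forms_eq_sq k hS hu2 (p := F f)
    (q := F e) (r := r) (s := s) (a := w₃) (b := -(w₃ * l)) (c := w₄) (d := w₄ * l)
    hw₃u (hw₃u.mul hul).neg hw₄u (hw₄u.mul hul)
    (by
      have : IsUnit (2 * l * w₃ * w₄) := by simp [*]
      convert this using 1; ring)
    hFfm hFem hFfe (by linear_combination (-r ^ 2) * hw₃ - w₃ * hr)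
    (by linear_combination (-s ^ 2) * hw₄ - w₄ * hs)
  have hzero {x : S} (hx : ∀ k : ℕ, x ∈ maximalIdeal S ^ 2 ^ k) : x = 0 := by
    rw [← Ideal.mem_bot, ← Ideal.iInf_pow_eq_bot_of_isLocalRing (maximalIdeal S)
      (Ideal.IsPrime.ne_top'), Ideal.mem_iInf]
    exact fun k => Ideal.pow_le_pow_right Nat.lt_two_pow_self.le (hx k)
  rw [hzero fun k => (key k).1, hzero fun k => (key k).2] at hFfe
  exact not_isUnit_zero (hFfe dvd_rfl dvd_rfl)

theorem IsLocalRing.HasRegularPair.dvd_or_dvd {R : Type u} [CommRing R] [IsDomain R]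
    [IsLocalRing R] [IsNoetherianRing R] (hR : HasRegularPair R) (h2 : IsUnit (2 : R))
    {a b c d : R} (hb : b ≠ 0) (hd : d ≠ 0) (h : d ^ 2 * (b ^ 4 + a ^ 4) = c ^ 2 * b ^ 4) :
    b ∣ a ∨ a ∣ b := by
  have := hR.uniqueFactorizationMonoid
  obtain ⟨a, b, g, hab, rfl, rfl⟩ :=
    UniqueFactorizationMonoid.exists_reduced_factors' a b hb
  have hg : g ≠ 0 := left_ne_zero_of_mul hb
  have h : d ^ 2 * (b ^ 4 + a ^ 4) = (c * b ^ 2) ^ 2 :=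
    mul_left_cancel₀ (pow_ne_zero 4 hg) (by linear_combination h)
  obtain ⟨c', hc'⟩ : d ∣ c * b ^ 2 :=
    (IsIntegrallyClosed.pow_dvd_pow_iff two_ne_zero).mp ⟨_, h.symm⟩
  have h : b ^ 4 + a ^ 4 = c' ^ 2 :=
    mul_left_cancel₀ (pow_ne_zero 2 hd) (by rw [h, hc', mul_pow])
  by_cases hbm : IsUnit b
  · exact .inl (mul_dvd_mul_left g hbm.dvd)
  by_cases ham : IsUnit a
  · exact .inr (mul_dvd_mul_left g ham.dvd)
  exact (hR.pow_four_add_pow_four_ne_sq h2 ham hbm hab h).elim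

/-- A local ring of dimension at least `n` whose maximal ideal can be generated by `n` elements. -/
def IsLocalRing.IsRegularOfDim (n : ℕ) (R : Type*) [CommRing R] [IsLocalRing R] : Prop :=
  (∃ s : Finset R, Ideal.span (s : Set R) = maximalIdeal R ∧ s.card ≤ n) ∧
    (n : WithBot ℕ∞) ≤ ringKrullDim R

/-- An ideal `I` of a local ring `R` such that the maximal ideal is not associated to `R ⧸ I`. -/
def IsLocalRing.IsSaturated {R : Type*} [CommRing R] [IsLocalRing R] (I : Ideal R) : Prop :=
  ∀ g, (∀ z ∈ maximalIdeal R, z * g ∈ I) → g ∈ I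

namespace IsLocalRing

theorem exists_mem_maximalIdeal_notMem_sq {R : Type*} [CommRing R] [IsLocalRing R]
    [IsNoetherianRing R] (h0 : maximalIdeal R ≠ ⊥) {T : Set (Ideal R)} (hT : T.Finite)
    (hprime : ∀ p ∈ T, p.IsPrime) (hne : maximalIdeal R ∉ T) :
    ∃ y ∈ maximalIdeal R, y ∉ maximalIdeal R ^ 2 ∧ ∀ p ∈ T, y ∉ p := by
  by_contra! hcon
  obtain ⟨p, hp, hle⟩ := (Ideal.subset_union_prime_finite (I := maximalIdeal R)
    (hT.insert (maximalIdeal R ^ 2)) (f := id) (maximalIdeal R ^ 2) (maximalIdeal R ^ 2)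
    fun p hp hp2 _ => hprime p (hp.resolve_left hp2)).mp fun y hy => by
      by_cases hy2 : y ∈ maximalIdeal R ^ 2
      · exact Set.mem_biUnion (Set.mem_insert _ _) hy2
      · obtain ⟨p, hp, hyp⟩ := hcon y hy hy2
        exact Set.mem_biUnion (Set.mem_insert_of_mem _ hp) hyp
  rcases hp with rfl | hp
  · refine h0 (Submodule.eq_bot_of_le_smul_of_le_jacobson_bot (maximalIdeal R) _
      (maximalIdeal R).fg_of_isNoetherianRing ?_ (maximalIdeal_le_jacobson _))
    simpa [sq] using hle
  · have := (maximalIdeal.isMaximal R).eq_of_le (hprime p hp).ne_top hle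
    exact hne (this ▸ hp)

theorem exists_regular_mem_maximalIdeal_notMem_sq {R : Type*} [CommRing R] [IsLocalRing R]
    [IsNoetherianRing R] (h0 : maximalIdeal R ≠ ⊥) {T : Set (Ideal R)} (hT : T.Finite)
    (hsat : ∀ I ∈ T, IsSaturated I) :
    ∃ y ∈ maximalIdeal R, y ∉ maximalIdeal R ^ 2 ∧ ∀ I ∈ T, ∀ g, y * g ∈ I → g ∈ I := by
  obtain ⟨y, hy, hy2, hyT⟩ := exists_mem_maximalIdeal_notMem_sq h0
    (T := ⋃ I ∈ T, associatedPrimes R (R ⧸ I))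
    (hT.biUnion fun I _ => associatedPrimes.finite R (R ⧸ I))
    (fun p hp => by
      obtain ⟨I, -, hI⟩ := Set.mem_iUnion₂.mp hp
      exact hI.isPrime)
    (fun hp => by
      obtain ⟨I, hIT, hI⟩ := Set.mem_iUnion₂.mp hp
      rw [AssociatedPrimes.mem_iff, isAssociatedPrime_iff] at hI
      obtain ⟨hprime, x, hx⟩ := hI
      obtain ⟨x, rfl⟩ := Ideal.Quotient.mk_surjective x
      have hxI : x ∈ I := hsat I hIT x fun z hz => by
        rw [hx, Submodule.mem_colon_singleton] at hz
        exact Ideal.Quotient.eq_zero_iff_mem.mp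
          (show z • Ideal.Quotient.mk I x = 0 by simpa using hz)
      refine hprime.ne_top ((Ideal.eq_top_iff_one _).mpr ?_)
      rw [hx, Submodule.mem_colon_singleton, Ideal.Quotient.eq_zero_iff_mem.mpr hxI]
      simp)
  refine ⟨y, hy, hy2, fun I hI g hg => ?_⟩
  by_contra hgI
  have : y ∈ ⋃ p ∈ associatedPrimes R (R ⧸ I), (p : Set R) := by
    rw [biUnion_associatedPrimes_eq_zero_divisors]
    exact ⟨Ideal.Quotient.mk I g, fun h => hgI (Ideal.Quotient.eq_zero_iff_mem.mp h),
      Ideal.Quotient.eq_zero_iff_mem.mpr hg⟩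
  obtain ⟨p, hp, hyp⟩ := Set.mem_iUnion₂.mp this
  exact hyT p (Set.mem_biUnion hI hp) hyp

theorem isLocalRing_quotient_span_singleton {R : Type*} [CommRing R] [IsLocalRing R] {y : R}
    (hy : y ∈ maximalIdeal R) : IsLocalRing (R ⧸ Ideal.span {y}) := by
  have : Nontrivial (R ⧸ Ideal.span {y}) := Ideal.Quotient.nontrivial_iff.mpr fun h =>
    hy (Ideal.span_singleton_eq_top.mp h)
  exact .of_surjective' _ Ideal.Quotient.mk_surjective

namespace IsRegularOfDim

theorem maximalIdeal_ne_bot {R : Type*} [CommRing R] [IsLocalRing R] {n : ℕ}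
    (h : IsRegularOfDim (n + 1) R) : maximalIdeal R ≠ ⊥ := by
  intro h0
  have h1 := h.2
  rw [ringKrullDim_eq_zero_of_isField (isField_iff_maximalIdeal_eq.mpr h0)] at h1
  have : n + 1 ≤ 0 := by exact_mod_cast h1
  omega

theorem quotient {R : Type*} [CommRing R] [IsLocalRing R] [IsNoetherianRing R] {n : ℕ}
    (h : IsRegularOfDim (n + 1) R) {y : R} (hy : y ∈ maximalIdeal R)
    (hy2 : y ∉ maximalIdeal R ^ 2) [IsLocalRing (R ⧸ Ideal.span {y})] :
    IsRegularOfDim n (R ⧸ Ideal.span {y}) := by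
  classical
  obtain ⟨⟨s, hs, hcard⟩, hdim⟩ := h
  constructor
  · obtain ⟨c, -, hc⟩ := Submodule.mem_span_finset.mp (hs.symm ▸ hy : y ∈ Ideal.span (s : Set R))
    obtain ⟨t, hts, ht⟩ : ∃ t ∈ s, IsUnit (c t) := by
      by_contra! hcon
      refine hy2 (hc ▸ Ideal.sum_mem _ fun t ht => ?_)
      rw [sq]
      exact Ideal.mul_mem_mul (hcon t ht) (hs ▸ Ideal.subset_span ht)
    refine ⟨(s.erase t).image (Ideal.Quotient.mk _), ?_, ?_⟩
    · rw [← IsLocalRing.map_maximalIdeal_of_surjective (Ideal.Quotient.mk (Ideal.span {y}))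
        Ideal.Quotient.mk_surjective, ← hs, Ideal.map_span, Finset.coe_image]
      refine le_antisymm (Ideal.span_mono (Set.image_mono (by simp))) (Ideal.span_le.mpr ?_)
      have hmem (x : R) (hx : x ∈ s) (hxt : x ≠ t) : Ideal.Quotient.mk (Ideal.span {y}) x ∈
          Ideal.span (Ideal.Quotient.mk (Ideal.span {y}) '' (s.erase t : Finset R)) :=
        Ideal.subset_span ⟨x, by simp [hx, hxt], rfl⟩
      rintro _ ⟨x, hx, rfl⟩
      by_cases hxt : x = t
      · subst hxt
        have h0 : Ideal.Quotient.mk (Ideal.span {y}) (∑ i ∈ s, c i • i) = 0 :=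
          Ideal.Quotient.eq_zero_iff_mem.mpr (hc ▸ Ideal.mem_span_singleton_self y)
        rw [← Finset.add_sum_erase s _ hts, map_add, map_sum, smul_eq_mul, map_mul] at h0
        refine (Ideal.unit_mul_mem_iff_mem _ (ht.map (Ideal.Quotient.mk (Ideal.span {y})))).mp ?_
        rw [eq_neg_of_add_eq_zero_left h0]
        refine neg_mem (Ideal.sum_mem _ fun z hz => ?_)
        rw [smul_eq_mul, map_mul]
        exact Ideal.mul_mem_left _ _
          (hmem z (Finset.mem_of_mem_erase hz) (Finset.ne_of_mem_erase hz))
      · exact hmem x hx hxt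
    · refine Finset.card_image_le.trans ?_
      rw [Finset.card_erase_of_mem hts]
      omega
  · have := hdim.trans (ringKrullDim_le_ringKrullDim_quotient_add_card {y}
      (by simpa [IsLocalRing.ringJacobson_eq_maximalIdeal] using hy))
    rw [Finset.coe_singleton, Finset.card_singleton] at this
    push_cast at this
    exact (WithBot.add_le_add_iff_right' WithBot.one_ne_bot
      fun h1 => ENat.one_ne_top (WithBot.coe_injective h1)).mp this

theorem isDomain {n : ℕ} {R : Type u} [CommRing R] [IsLocalRing R] [IsNoetherianRing R]
    (h : IsRegularOfDim n R) : IsDomain R := by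
  induction n generalizing R with
  | zero =>
    obtain ⟨⟨s, hs, hcard⟩, -⟩ := h
    have h0 : maximalIdeal R = ⊥ := by
      rw [← hs, Finset.card_eq_zero.mp (Nat.le_zero.mp hcard)]
      simp
    exact (isField_iff_maximalIdeal_eq.mpr h0).isDomain
  | succ n ih =>
    obtain ⟨y, hy, hy2, hyT⟩ := exists_mem_maximalIdeal_notMem_sq h.maximalIdeal_ne_bot
      (minimalPrimes.finite_of_isNoetherianRing R) (fun p hp => hp.1.1) (fun hm => by
        have h1 := h.2
        rw [← maximalIdeal_height_eq_ringKrullDim,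
          (Ideal.height_eq_zero_iff).mpr hm] at h1
        have : n + 1 ≤ 0 := by exact_mod_cast h1
        omega)
    have := isLocalRing_quotient_span_singleton hy
    have := ih (h.quotient hy hy2)
    have hp := (Ideal.Quotient.isDomain_iff_prime (Ideal.span {y})).mp this
    obtain ⟨p, hpm, hle⟩ := Ideal.exists_minimalPrimes_le (I := (⊥ : Ideal R))
      (J := Ideal.span {y}) bot_le
    have hpp : p.IsPrime := hpm.1.1
    have := hpp.eq_bot_of_le_span_singleton hy hle (hyT p hpm)
    subst this
    exact IsDomain.of_bot_isPrime R

theorem exists_prime_mem {n : ℕ} {R : Type u} [CommRing R] [IsLocalRing R] [IsNoetherianRing R]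
    (h : IsRegularOfDim (n + 2) R) :
    ∃ y ∈ maximalIdeal R, y ∉ maximalIdeal R ^ 2 ∧ Prime y := by
  have := h.isDomain
  obtain ⟨y, hy, hy2, -⟩ := exists_mem_maximalIdeal_notMem_sq h.maximalIdeal_ne_bot
    Set.finite_empty (by simp) (by simp)
  have := isLocalRing_quotient_span_singleton hy
  have := (h.quotient hy hy2).isDomain
  refine ⟨y, hy, hy2, (Ideal.span_singleton_prime ?_).mp
    ((Ideal.Quotient.isDomain_iff_prime (Ideal.span {y})).mp this)⟩
  rintro rfl
  exact hy2 (zero_mem _)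

theorem hasRegularPair {R : Type u} [CommRing R] [IsLocalRing R] [IsNoetherianRing R]
    (h : IsRegularOfDim 2 R) : HasRegularPair R := by
  have := h.isDomain
  obtain ⟨x, hx, hx2, hxp⟩ := h.exists_prime_mem
  have := isLocalRing_quotient_span_singleton hx
  have hq := h.quotient hx hx2
  have hq0 := hq.maximalIdeal_ne_bot
  obtain ⟨⟨s, hs, hcard⟩, -⟩ := hq
  obtain ⟨y, hy⟩ := Finset.card_le_one_iff_subset_singleton.mp hcard
  obtain ⟨y, rfl⟩ := Ideal.Quotient.mk_surjective y
  have hmax : maximalIdeal (R ⧸ Ideal.span {x}) = Ideal.span {Ideal.Quotient.mk _ y} := by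
    rcases Finset.subset_singleton_iff.mp hy with rfl | rfl
    · exact (hq0 (by rw [← hs]; simp)).elim
    · rw [← hs, Finset.coe_singleton]
  have hxy : ¬ x ∣ y := by
    rw [← Ideal.Quotient.eq_zero_iff_dvd]
    intro h0
    rw [h0] at hmax
    exact hq0 (by simpa using hmax)
  refine ⟨x, y, le_antisymm (fun z hz => ?_) ?_, isWeaklyRegular_pair_iff.mpr
    ⟨fun r hr => (mul_eq_zero.mp hr).resolve_left hxp.ne_zero,
      fun r hr => (hxp.dvd_or_dvd hr).resolve_left hxy⟩⟩
  · have hz' : Ideal.Quotient.mk (Ideal.span {x}) z ∈ maximalIdeal (R ⧸ Ideal.span {x}) := by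
      rw [← IsLocalRing.map_maximalIdeal_of_surjective (Ideal.Quotient.mk (Ideal.span {x}))
        Ideal.Quotient.mk_surjective]
      exact Ideal.mem_map_of_mem _ hz
    rw [hmax] at hz'
    obtain ⟨r, hr⟩ := Ideal.mem_span_singleton.mp hz'
    obtain ⟨r, rfl⟩ := Ideal.Quotient.mk_surjective r
    rw [← map_mul, Ideal.Quotient.eq, Ideal.mem_span_singleton] at hr
    obtain ⟨w, hw⟩ := hr
    exact Ideal.mem_span_pair.mpr ⟨w, r, by linear_combination -hw⟩
  · have hym : Ideal.Quotient.mk (Ideal.span {x}) y ∈ maximalIdeal (R ⧸ Ideal.span {x}) :=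
      hmax ▸ Ideal.mem_span_singleton_self _
    rw [Ideal.span_le, Set.pair_subset_iff]
    refine ⟨hx, fun hu => hym (hu.map (Ideal.Quotient.mk (Ideal.span {x})))⟩

theorem isSaturated_span_singleton {n : ℕ} {R : Type u} [CommRing R] [IsLocalRing R]
    [IsNoetherianRing R] (h : IsRegularOfDim (n + 2) R) {b : R} (hb : b ≠ 0) :
    IsSaturated (Ideal.span {b}) := by
  have := h.isDomain
  obtain ⟨y, hy, hy2, hyp⟩ := h.exists_prime_mem
  have := isLocalRing_quotient_span_singleton hy
  obtain ⟨z, hz, hyz⟩ : ∃ z ∈ maximalIdeal R, ¬ y ∣ z := by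
    by_contra! hcon
    refine (h.quotient hy hy2).maximalIdeal_ne_bot ?_
    rw [← IsLocalRing.map_maximalIdeal_of_surjective (Ideal.Quotient.mk (Ideal.span {y}))
      Ideal.Quotient.mk_surjective, Ideal.map_eq_bot_iff_le_ker, Ideal.mk_ker]
    exact fun z hz => Ideal.mem_span_singleton.mpr (hcon z hz)
  intro g hg
  obtain ⟨r, hr⟩ := Ideal.mem_span_singleton.mp (hg y hy)
  obtain ⟨k, hk⟩ := Ideal.mem_span_singleton.mp (hg z hz)
  have hzr : z * r = y * k := mul_left_cancel₀ hb (by linear_combination y * hk - z * hr)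
  obtain ⟨t, rfl⟩ := (hyp.dvd_or_dvd ⟨k, hzr⟩).resolve_left hyz
  exact Ideal.mem_span_singleton.mpr
    ⟨t, mul_left_cancel₀ hyp.ne_zero (by linear_combination hr)⟩

theorem isSaturated_span_pair {n : ℕ} {R : Type u} [CommRing R] [IsLocalRing R]
    [IsNoetherianRing R] (h : IsRegularOfDim (n + 3) R) {b y : R} (hy : y ∈ maximalIdeal R)
    (hy2 : y ∉ maximalIdeal R ^ 2) (hyb : ¬ y ∣ b) : IsSaturated (Ideal.span {b, y}) := by
  have := isLocalRing_quotient_span_singleton hy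
  have hq := (h.quotient hy hy2).isSaturated_span_singleton (b := Ideal.Quotient.mk _ b)
    (by rwa [Ne, Ideal.Quotient.eq_zero_iff_dvd])
  have hiff (g : R) : g ∈ Ideal.span {b, y} ↔
      Ideal.Quotient.mk (Ideal.span {y}) g ∈ Ideal.span {Ideal.Quotient.mk (Ideal.span {y}) b} := by
    rw [← Set.image_singleton, ← Ideal.map_span, ← Ideal.mem_comap,
      Ideal.comap_map_quotientMk, ← Ideal.span_union, Set.union_comm, Set.singleton_union]
  intro g hg
  refine (hiff g).mpr (hq _ fun z hz => ?_)
  rw [← IsLocalRing.map_maximalIdeal_of_surjective (Ideal.Quotient.mk (Ideal.span {y}))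
      Ideal.Quotient.mk_surjective] at hz
  obtain ⟨z, hzm, rfl⟩ := (Ideal.mem_map_iff_of_surjective _ Ideal.Quotient.mk_surjective).mp hz
  rw [← map_mul]
  exact (hiff _).mp (hg z hzm)

end IsRegularOfDim

end IsLocalRing

namespace IsLocalRing

/-- `Y ∈ m ^ i` is a nonzerodivisor modulo `b`, the maximal ideal `m` is not associated to
`R ⧸ (b, Y)`, and `a` vanishes in that quotient. -/
structure IsApproxDivisor {R : Type*} [CommRing R] [IsLocalRing R] (b a Y : R) (i : ℕ) : Prop where
  mem_pow : Y ∈ maximalIdeal R ^ i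
  dvd_of_dvd_mul : ∀ g, b ∣ Y * g → b ∣ g
  isSaturated : IsSaturated (Ideal.span {b, Y})
  mem_span : a ∈ Ideal.span {b, Y}

theorem isApproxDivisor_one {R : Type*} [CommRing R] [IsLocalRing R] (b a : R) :
    IsApproxDivisor b a 1 0 where
  mem_pow := by simp
  dvd_of_dvd_mul g hg := by simpa using hg
  isSaturated g _ := Ideal.mem_span_pair.mpr ⟨0, g, by ring⟩
  mem_span := Ideal.mem_span_pair.mpr ⟨0, a, by ring⟩

theorem IsApproxDivisor.mul {R : Type*} [CommRing R] [IsDomain R] [IsLocalRing R]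
    {b a Y y : R} {i : ℕ} (h : IsApproxDivisor b a Y i) (hy : y ∈ maximalIdeal R)
    (hyb : ∀ g, b ∣ y * g → b ∣ g)
    (hyY : ∀ g, y * g ∈ Ideal.span {b, Y} → g ∈ Ideal.span {b, Y})
    (hsat : IsSaturated (Ideal.span {b, y})) (ha : a ∈ Ideal.span {b, y}) :
    IsApproxDivisor b a (Y * y) (i + 1) := by
  simp only [IsSaturated, Ideal.mem_span_pair] at *
  have hYy (g : R) (hg : ∃ h l, h * b + l * y = Y * g) : ∃ p q, p * b + q * y = g := by
    obtain ⟨h', l, hl⟩ := hg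
    obtain ⟨s, t, hst⟩ := hyY l ⟨-h', g, by linear_combination -hl⟩
    obtain ⟨k, hk⟩ := h.dvd_of_dvd_mul (g - t * y)
      ⟨h' + s * y, by linear_combination -hl - y * hst⟩
    exact ⟨k, t, by linear_combination -hk⟩
  refine ⟨?_, fun g hg => hyb g (h.dvd_of_dvd_mul _ (by rwa [← mul_assoc])), ?_, ?_⟩
  · rw [pow_succ]
    exact Ideal.mul_mem_mul h.mem_pow hy
  · intro g hg
    have hsatY := h.isSaturated
    simp only [IsSaturated, Ideal.mem_span_pair] at hsatY ⊢
    simp only [Ideal.mem_span_pair] at hg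
    obtain ⟨s, t, rfl⟩ := hsatY g fun z hz => by
      obtain ⟨k, l, hkl⟩ := hg z hz
      exact ⟨k, l * y, by linear_combination hkl⟩
    obtain ⟨p, q, rfl⟩ := hsat t fun z hz => by
      obtain ⟨k, l, hkl⟩ := hg z hz
      obtain ⟨w, hw⟩ := h.dvd_of_dvd_mul (z * t - y * l)
        ⟨k - z * s, by linear_combination -hkl⟩
      exact ⟨w, l, by linear_combination -hw⟩
    exact ⟨s + p * Y, q, by ring⟩
  · have haY := h.mem_span
    simp only [Ideal.mem_span_pair] at haY ⊢
    obtain ⟨r, s, hrs⟩ := haY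
    obtain ⟨p', q', hpq'⟩ := ha
    obtain ⟨p, q, rfl⟩ := hYy s ⟨p' - r, q', by linear_combination hpq' - hrs⟩
    exact ⟨r + p * Y, q, by linear_combination hrs⟩

theorem dvd_of_forall_mem_span_sup_pow {R : Type*} [CommRing R] [IsLocalRing R]
    [IsNoetherianRing R] {a b : R} (h : ∀ M, a ∈ Ideal.span {b} ⊔ maximalIdeal R ^ M) : b ∣ a := by
  rw [← Ideal.Quotient.eq_zero_iff_dvd, ← Submodule.mem_bot R,
    ← Ideal.iInf_pow_smul_eq_bot_of_isLocalRing (M := R ⧸ Ideal.span {b}) (maximalIdeal R)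
      Ideal.IsPrime.ne_top', Submodule.mem_iInf]
  intro M
  obtain ⟨r, hr, z, hz, rfl⟩ := Submodule.mem_sup.mp (h M)
  rw [map_add, Ideal.Quotient.eq_zero_iff_mem.mpr hr, zero_add]
  have := Submodule.smul_mem_smul hz (Submodule.mem_top (R := R)
    (x := (1 : R ⧸ Ideal.span {b})))
  rwa [Algebra.smul_def, mul_one] at this

theorem IsRegularOfDim.dvd_or_dvd {n : ℕ} {R : Type u} [CommRing R] [IsLocalRing R]
    [IsNoetherianRing R] (hR : IsRegularOfDim (n + 2) R) (h2 : IsUnit (2 : R))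
    {a b c d : R} (hb : b ≠ 0) (hd : d ≠ 0) (h : d ^ 2 * (b ^ 4 + a ^ 4) = c ^ 2 * b ^ 4) :
    b ∣ a ∨ a ∣ b := by
  have hdom := hR.isDomain
  induction n generalizing R with
  | zero => exact hR.hasRegularPair.dvd_or_dvd h2 hb hd h
  | succ n ih =>
    by_cases ha : a = 0
    · exact .inl (ha ▸ dvd_zero b)
    have hf : a * b * d ≠ 0 := mul_ne_zero (mul_ne_zero ha hb) hd
    have key (N : ℕ) : ∃ i j Y Z, i + j = N ∧ IsApproxDivisor b a Y i ∧ IsApproxDivisor a b Z j := by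
      induction N with
      | zero => exact ⟨0, 0, 1, 1, rfl, isApproxDivisor_one b a, isApproxDivisor_one a b⟩
      | succ N hN =>
        obtain ⟨i, j, Y, Z, hij, hY, hZ⟩ := hN
        obtain ⟨y, hy, hy2, hyT⟩ := exists_regular_mem_maximalIdeal_notMem_sq
          hR.maximalIdeal_ne_bot
          (T := {Ideal.span {a * b * d}, Ideal.span {b, Y}, Ideal.span {a, Z}})
          (by simp) (by
            rintro I (rfl | rfl | rfl)
            exacts [hR.isSaturated_span_singleton hf, hY.isSaturated, hZ.isSaturated])
        have hyf (g : R) (hg : a * b * d ∣ y * g) : a * b * d ∣ g :=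
          Ideal.mem_span_singleton.mp (hyT _ (by simp) g (Ideal.mem_span_singleton.mpr hg))
        have hyY := hyT (Ideal.span {b, Y}) (by simp)
        have hyZ := hyT (Ideal.span {a, Z}) (by simp)
        have hyabd : ¬ y ∣ a * b * d := by
          rintro ⟨g, hg⟩
          obtain ⟨t, ht⟩ := hyf g ⟨1, by rw [← hg, mul_one]⟩
          refine hy (IsUnit.of_mul_eq_one t (mul_left_cancel₀ hf ?_))
          linear_combination (-y) * ht - hg
        have hya : ¬ y ∣ a := fun h' => hyabd ((h'.mul_right b).mul_right d)
        have hyb : ¬ y ∣ b := fun h' => hyabd ((h'.mul_left a).mul_right d)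
        have hyd : ¬ y ∣ d := fun h' => hyabd (h'.mul_left _)
        have hregb (g : R) (hg : b ∣ y * g) : b ∣ g := by
          rw [← mul_dvd_mul_iff_left (mul_ne_zero ha hd)]
          convert hyf (a * d * g) ?_ using 1
          · ring
          · convert mul_dvd_mul_left (a * d) hg using 1 <;> ring
        have hrega (g : R) (hg : a ∣ y * g) : a ∣ g := by
          rw [← mul_dvd_mul_iff_left (mul_ne_zero hb hd)]
          convert hyf (b * d * g) ?_ using 1
          · ring
          · convert mul_dvd_mul_left (b * d) hg using 1 <;> ring
        have hloc := isLocalRing_quotient_span_singleton hy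
        have hq : IsRegularOfDim (n + 2) (R ⧸ Ideal.span {y}) := hR.quotient hy hy2
        have hmem {a b : R} (h : Ideal.Quotient.mk (Ideal.span {y}) b ∣ Ideal.Quotient.mk _ a) :
            a ∈ Ideal.span {b, y} := by
          obtain ⟨r, hr⟩ := h
          obtain ⟨r, rfl⟩ := Ideal.Quotient.mk_surjective r
          rw [← map_mul, Ideal.Quotient.eq, Ideal.mem_span_singleton] at hr
          obtain ⟨w, hw⟩ := hr
          exact Ideal.mem_span_pair.mpr ⟨r, w, by linear_combination -hw⟩
        have hdvd := ih hq
          (by simpa only [map_ofNat] using h2.map (Ideal.Quotient.mk (Ideal.span {y})))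
          (a := Ideal.Quotient.mk _ a) (b := Ideal.Quotient.mk _ b) (c := Ideal.Quotient.mk _ c)
          (d := Ideal.Quotient.mk _ d)
          (by rwa [Ne, Ideal.Quotient.eq_zero_iff_dvd])
          (by rwa [Ne, Ideal.Quotient.eq_zero_iff_dvd])
          (by simp only [← map_pow, ← map_add, ← map_mul, h]) hq.isDomain
        rcases hdvd with hdvd | hdvd
        · exact ⟨i + 1, j, Y * y, Z, by omega,
            hY.mul hy hregb hyY (hR.isSaturated_span_pair hy hy2 hyb) (hmem hdvd), hZ⟩
        · exact ⟨i, j + 1, Y, Z * y, by omega, hY,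
            hZ.mul hy hrega hyZ (hR.isSaturated_span_pair hy hy2 hya) (hmem hdvd)⟩
    have hmem {a b Y : R} {i M : ℕ} (h : IsApproxDivisor b a Y i) (hM : M ≤ i) :
        a ∈ Ideal.span {b} ⊔ maximalIdeal R ^ M := by
      refine (Ideal.span_le.mpr ?_ : Ideal.span {b, Y} ≤ _) h.mem_span
      rw [Set.pair_subset_iff]
      exact ⟨Ideal.mem_sup_left (Ideal.mem_span_singleton_self b),
        Ideal.mem_sup_right (Ideal.pow_le_pow_right hM h.mem_pow)⟩
    by_cases hall : ∀ M, a ∈ Ideal.span {b} ⊔ maximalIdeal R ^ M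
    · exact .inl (dvd_of_forall_mem_span_sup_pow hall)
    push Not at hall
    obtain ⟨M₀, hM₀⟩ := hall
    refine .inr (dvd_of_forall_mem_span_sup_pow fun M => ?_)
    obtain ⟨i, j, Y, Z, hij, hY, hZ⟩ := key (M₀ + M)
    rcases le_or_gt M₀ i with hi | hi
    · exact (hM₀ (hmem hY hi)).elim
    · exact hmem hZ (by omega)

end IsLocalRing

theorem IsRegularLocal.dvd_or_dvd {R : Type u} [CommRing R] [IsLocalRing R]
    (hreg : IsRegularLocal R) (hdim : 2 ≤ ringKrullDim R) (h2 : IsUnit (2 : R))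
    {a b c d : R} (hb : b ≠ 0) (hd : d ≠ 0) (h : d ^ 2 * (b ^ 4 + a ^ 4) = c ^ 2 * b ^ 4) :
    b ∣ a ∨ a ∣ b := by
  obtain ⟨_, s, hs, hcard⟩ := hreg
  obtain ⟨n, hn⟩ : ∃ n, s.card = n + 2 := by
    rw [← hcard] at hdim
    have : ((2 : ℕ) : WithBot ℕ∞) ≤ (s.card : WithBot ℕ∞) := hdim
    rw [Nat.cast_le] at this
    exact ⟨s.card - 2, by omega⟩
  have hR : IsRegularOfDim (n + 2) R := ⟨⟨s, hs, hn.le⟩, by rw [← hcard, hn]; rfl⟩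
  exact hR.dvd_or_dvd h2 hb hd h

theorem IsLocalRing.isUnit_two_of_ringChar_ne_two {R : Type*} [CommRing R] [IsLocalRing R]
    (h : ringChar (ResidueField R) ≠ 2) : IsUnit (2 : R) := by
  have h2 : (2 : ResidueField R) ≠ 0 := Ring.two_ne_zero h
  rw [← map_ofNat (residue R) 2] at h2
  exact (residue_ne_zero_iff_isUnit 2).mp h2

/-- If `R` is a Henselian regular local ring of dimension `≥ 2` with residue
characteristic `≠ 2` and fraction field `K`, and `α, β ∈ K` satisfy `1 + α⁴ = β²`,
then `α ∈ R` or `1/α ∈ R`. -/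
theorem stmt6 (R K : Type*) [CommRing R] [IsDomain R] [HenselianLocalRing R]
    (hreg : IsRegularLocal R) (hdim : 2 ≤ ringKrullDim R)
    (hchar : ringChar (IsLocalRing.ResidueField R) ≠ 2)
    [Field K] [Algebra R K] [IsFractionRing R K]
    (α β : K) (h : 1 + α ^ 4 = β ^ 2) :
    (∃ r : R, α = algebraMap R K r) ∨ (∃ r : R, α⁻¹ = algebraMap R K r) := by
  obtain ⟨a, b, hb, rfl⟩ := IsFractionRing.div_surjective (A := R) α
  obtain ⟨c, d, hd, rfl⟩ := IsFractionRing.div_surjective (A := R) β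
  have hb0 := nonZeroDivisors.ne_zero hb
  have hd0 := nonZeroDivisors.ne_zero hd
  have hbK : algebraMap R K b ≠ 0 := by simpa using hb0
  have hdK : algebraMap R K d ≠ 0 := by simpa using hd0
  have heq : d ^ 2 * (b ^ 4 + a ^ 4) = c ^ 2 * b ^ 4 := by
    apply IsFractionRing.injective R K
    simp only [map_mul, map_add, map_pow]
    field_simp at h
    linear_combination h
  rcases hreg.dvd_or_dvd hdim (isUnit_two_of_ringChar_ne_two hchar) hb0 hd0 heq with
    ⟨r, rfl⟩ | ⟨r, rfl⟩
  · exact .inl ⟨r, by rw [map_mul, mul_div_cancel_left₀ _ hbK]⟩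
  · refine .inr ⟨r, ?_⟩
    rw [map_mul] at hbK
    rw [inv_div, map_mul, mul_div_cancel_left₀ _ (left_ne_zero_of_mul hbK)]
end

section
/- Let R be a regular local ring of dimension ≥ 2 with fraction field K and residue characteristic ≠ 2. If α, β ∈ K satisfy 1 + α⁴ = β², then α ∈ R or 1/α ∈ R. (Reduction of the general regular case to the Henselian case via the Henselization.) -/
section

open IsLocalRing nonZeroDivisors

theorem IsLocalRing.forall_pow_dvd {R : Type*} [CommRing R] [IsLocalRing R] [IsNoetherianRing R]
    {x a : R} (hx : x ∈ maximalIdeal R) (h : ∀ n, x ^ n ∣ a) : a = 0 := by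
  have := Ideal.iInf_pow_eq_bot_of_isLocalRing (Ideal.span {x})
    (fun e ↦ (mem_maximalIdeal x).mp hx (Ideal.span_singleton_eq_top.mp e))
  rw [← Ideal.mem_bot, ← this, Ideal.mem_iInf]
  intro n
  rw [Ideal.span_singleton_pow, Ideal.mem_span_singleton]
  exact h n

theorem IsLocalRing.finiteMultiplicity {R : Type*} [CommRing R] [IsLocalRing R]
    [IsNoetherianRing R] {x a : R} (hx : x ∈ maximalIdeal R) (ha : a ≠ 0) :
    FiniteMultiplicity x a := by
  by_contra h
  exact ha (forall_pow_dvd hx (FiniteMultiplicity.not_iff_forall.mp h))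

theorem IsLocalRing.isDomain_of_isPrime_span_singleton {R : Type*} [CommRing R] [IsLocalRing R]
    [IsNoetherianRing R] {x : R} (hx : x ∈ R⁰) (hp : (Ideal.span {x}).IsPrime) : IsDomain R := by
  have hxm : x ∈ maximalIdeal R :=
    le_maximalIdeal hp.ne_top (Ideal.mem_span_singleton_self x)
  have : NoZeroDivisors R := by
    refine ⟨fun {a b} hab ↦ ?_⟩
    by_contra! h
    obtain ⟨a', ha, ha'⟩ := (finiteMultiplicity hxm h.1).exists_eq_pow_mul_and_not_dvd
    obtain ⟨b', hb, hb'⟩ := (finiteMultiplicity hxm h.2).exists_eq_pow_mul_and_not_dvd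
    have h0 : a' * b' = 0 := by
      refine (mul_left_mem_nonZeroDivisors_eq_zero_iff
        (pow_mem hx (multiplicity x a + multiplicity x b))).mp ?_
      linear_combination hab - x ^ multiplicity x b * b' * ha - a * hb
    rcases hp.mem_or_mem (h0 ▸ zero_mem _ : a' * b' ∈ Ideal.span {x}) with h | h
    · exact ha' (Ideal.mem_span_singleton.mp h)
    · exact hb' (Ideal.mem_span_singleton.mp h)
  exact NoZeroDivisors.to_isDomain R

theorem IsLocalRing.uniqueFactorizationMonoid_of_maximalIdeal_eq_span_pair {R : Type*} [CommRing R]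
    [IsDomain R] [IsLocalRing R] [IsNoetherianRing R] {x y : R} (hx : Prime x)
    (hm : maximalIdeal R = Ideal.span {x, y}) : UniqueFactorizationMonoid R := by
  rw [UniqueFactorizationMonoid.iff_exists_prime_mem_of_isPrime]
  intro P hP0 hP
  by_cases hxP : x ∈ P
  · exact ⟨x, hxP, hx⟩
  have hxI : (Ideal.span {x}).IsPrime := (Ideal.span_singleton_prime hx.ne_zero).mpr hx
  have hxm : x ∈ maximalIdeal R := (mem_maximalIdeal x).mpr hx.not_isUnit
  let A := R ⧸ Ideal.span {x}
  have : IsLocalRing A := .of_surjective' (Ideal.Quotient.mk _) Ideal.Quotient.mk_surjective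
  have hA : (maximalIdeal A).IsPrincipal := by
    refine ⟨Ideal.Quotient.mk _ y, ?_⟩
    have : (maximalIdeal R).map (Ideal.Quotient.mk (Ideal.span {x})) = maximalIdeal A :=
      IsLocalRing.map_maximalIdeal_of_surjective _ Ideal.Quotient.mk_surjective
    rw [← this, hm, Ideal.map_span, Set.image_pair]
    rw [Ideal.submodule_span_eq, Ideal.Quotient.eq_zero_iff_mem.mpr (Ideal.mem_span_singleton_self x),
      Ideal.span_insert_zero]
  have : IsPrincipalIdealRing A :=
    ((tfae_of_isNoetherianRing_of_isLocalRing_of_isDomain A).out 4 0).mp hA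
  obtain ⟨g, hg⟩ := (IsPrincipalIdealRing.principal (P.map (Ideal.Quotient.mk (Ideal.span {x})))).1
  have hgm : g ∈ P.map (Ideal.Quotient.mk (Ideal.span {x})) := by
    rw [hg]; exact Submodule.mem_span_singleton_self g
  obtain ⟨f, hfP, rfl⟩ := (Ideal.mem_map_iff_of_surjective _ Ideal.Quotient.mk_surjective).mp hgm
  have hle : P ≤ Ideal.span {f} := by
    refine Submodule.le_of_le_smul_of_le_jacobson_bot (I := Ideal.span {x})
      (IsNoetherian.noetherian P) ?_ ?_
    · rw [IsLocalRing.jacobson_eq_maximalIdeal _ bot_ne_top, Ideal.span_singleton_le_iff_mem]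
      exact hxm
    · intro p hp
      have : Ideal.Quotient.mk (Ideal.span {x}) p ∈ P.map (Ideal.Quotient.mk (Ideal.span {x})) :=
        Ideal.mem_map_of_mem _ hp
      rw [hg, Ideal.submodule_span_eq, Ideal.mem_span_singleton] at this
      obtain ⟨r, hr⟩ := this
      obtain ⟨r, rfl⟩ := Ideal.Quotient.mk_surjective r
      rw [← map_mul, Ideal.Quotient.eq, Ideal.mem_span_singleton] at hr
      obtain ⟨w, hw⟩ := hr
      have hwP : w ∈ P := by
        refine (hP.mem_or_mem (?_ : x * w ∈ P)).resolve_left hxP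
        rw [← hw]
        exact sub_mem hp (P.mul_mem_right _ hfP)
      rw [show p = f * r + x * w by rw [← hw]; ring]
      exact Submodule.add_mem_sup (Ideal.mul_mem_right _ _ (Ideal.mem_span_singleton_self f))
        (Ideal.mul_mem_mul (Ideal.mem_span_singleton_self x) hwP)
  have hPf : P = Ideal.span {f} := le_antisymm hle ((Ideal.span_singleton_le_iff_mem _).mpr hfP)
  have hf0 : f ≠ 0 := by
    rintro rfl
    exact hP0 (by simpa using hPf)
  exact ⟨f, hfP, (Ideal.span_singleton_prime hf0).mp (hPf ▸ hP)⟩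

theorem IsLocalRing.exists_flat_extension_sqrt.{u} {R : Type u} [CommRing R] [IsLocalRing R]
    [IsNoetherianRing R] (h2 : IsUnit (2 : R)) {u : R} (hu : IsUnit u) :
    ∃ (S : Type u) (_ : CommRing S) (_ : IsLocalRing S) (_ : Algebra R S), IsNoetherianRing S ∧
      Module.Flat R S ∧ IsLocalHom (algebraMap R S) ∧
      (maximalIdeal R).map (algebraMap R S) = maximalIdeal S ∧
      ∃ w : S, w ^ 2 = algebraMap R S u := by
  open Polynomial in
  let P : StandardEtalePair R :=
    { f := X ^ 2 - C u
      monic_f := monic_X_pow_sub_C u two_ne_zero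
      g := 1
      cond := by
        obtain ⟨v, hv⟩ := hu.exists_right_inv
        obtain ⟨t, ht⟩ := h2.exists_right_inv
        refine ⟨C (t * v) * X, - C v, 1, ?_⟩
        have h1 : (C 2 * C t : R[X]) = 1 := by rw [← C_mul, ht, C_1]
        have h3 : (C u * C v : R[X]) = 1 := by rw [← C_mul, hv, C_1]
        simp only [derivative_sub, derivative_C, derivative_X_pow, C_mul]
        have h4 : (C ((2 : ℕ) : R) : R[X]) = C 2 := by simp
        rw [h4]
        linear_combination (C v * X ^ 2) * h1 + h3 }
  let k := AlgebraicClosure (ResidueField R)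
  let _ : Algebra R k := ((algebraMap (ResidueField R) k).comp (residue R)).toAlgebra
  obtain ⟨z, hz⟩ := IsAlgClosed.exists_pow_nat_eq (algebraMap R k u) two_pos
  have hmap : P.HasMap z := by
    refine ⟨?_, ?_⟩
    · simp [P, hz]
    · simp [P]
  let φ : P.Ring →ₐ[R] k := P.lift z hmap
  let Q : Ideal P.Ring := RingHom.ker φ
  have hQ : Q.IsPrime := RingHom.ker_isPrime _
  have : IsNoetherianRing P.Ring := Algebra.FiniteType.isNoetherianRing R P.Ring
  let S := Localization.AtPrime Q
  have hloc : IsLocalHom (algebraMap R S) := by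
    refine ⟨fun a ha ↦ ?_⟩
    by_contra hna
    have : algebraMap R P.Ring a ∈ Q := by
      rw [RingHom.mem_ker]
      rw [AlgHom.commutes]
      change algebraMap (ResidueField R) k (residue R a) = 0
      rw [(residue_eq_zero_iff a).mpr ((mem_maximalIdeal a).mpr hna), map_zero]
    rw [IsScalarTower.algebraMap_apply R P.Ring S,
      IsLocalization.AtPrime.isUnit_to_map_iff S Q] at ha
    exact ha this
  have : Algebra.FormallyUnramified P.Ring S :=
    Algebra.FormallyUnramified.of_isLocalization Q.primeCompl
  have : Algebra.FormallyUnramified R S := Algebra.FormallyUnramified.comp R P.Ring S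
  have : Algebra.EssFiniteType P.Ring S := Algebra.EssFiniteType.of_isLocalization S Q.primeCompl
  have : Algebra.EssFiniteType R S := Algebra.EssFiniteType.comp R P.Ring S
  have : Module.Flat R P.Ring := Algebra.Smooth.flat R P.Ring
  have : Module.Flat P.Ring S := IsLocalization.flat S Q.primeCompl
  refine ⟨S, inferInstance, inferInstance, inferInstance,
    IsLocalization.isNoetherianRing Q.primeCompl S inferInstance, Module.Flat.trans R P.Ring S,
    hloc, Algebra.FormallyUnramified.map_maximalIdeal, algebraMap P.Ring S P.X, ?_⟩
  have hX := P.hasMap_X.1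
  simp only [P, map_sub, map_pow, Polynomial.aeval_X, Polynomial.aeval_C, sub_eq_zero] at hX
  rw [← map_pow, hX, ← IsScalarTower.algebraMap_apply]

theorem Module.Flat.dvd_of_dvd_mul {R S : Type*} [CommRing R] [CommRing S] [Algebra R S]
    [Module.Flat R S] {x y : R} (h : ∀ r, x ∣ y * r → x ∣ r) {s : S}
    (hs : algebraMap R S x ∣ algebraMap R S y * s) : algebraMap R S x ∣ s := by
  obtain ⟨t, ht⟩ := hs
  obtain ⟨k, a, z, hz, ha⟩ := Module.Flat.isTrivialRelation_of_sum_smul_eq_zero (R := R) (M := S)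
    (f := ![y, -x]) (x := ![s, t]) (by simp [Algebra.smul_def, ht])
  have hs : s = ∑ j, a 0 j • z j := hz 0
  rw [hs]
  refine Finset.dvd_sum fun j _ ↦ ?_
  rw [Algebra.smul_def]
  refine (map_dvd (algebraMap R S) (h _ ⟨a 1 j, ?_⟩)).mul_right _
  have := ha j
  simp only [Fin.sum_univ_two, Matrix.cons_val_zero, Matrix.cons_val_one] at this
  linear_combination this

theorem IsLocalRing.exists_mul_pow_four_add_mul_pow_four_eq_sq {S : Type*} [CommRing S] [IsDomain S]
    [IsLocalRing S] [UniqueFactorizationMonoid S] (h2 : IsUnit (2 : S)) {w B a b c : S} {n : ℕ}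
    (hw : IsUnit w) (hB : IsUnit B) (h : w ^ 2 * a ^ 4 + B * b ^ 4 = c ^ 2)
    (ha : a ∈ maximalIdeal S) (hb : b ∈ maximalIdeal S) (hab : IsRelPrime a b)
    (hbn : b ∉ maximalIdeal S ^ (n + 1)) :
    ∃ A' B' a' b' c' : S, IsUnit A' ∧ IsUnit B' ∧ A' * a' ^ 4 + B' * b' ^ 4 = c' ^ 2 ∧
      a' ∈ maximalIdeal S ∧ b' ∈ maximalIdeal S ∧ IsRelPrime a' b' ∧ b' ∉ maximalIdeal S ^ n := by
  obtain ⟨v, hv⟩ := hB.exists_right_inv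
  have hc : c ∈ maximalIdeal S := by
    refine Ideal.IsPrime.mem_of_pow_mem inferInstance 2 ?_
    rw [← h]
    exact add_mem (Ideal.mul_mem_left _ _ (Ideal.pow_mem_of_mem _ ha 4 (by simp)))
      (Ideal.mul_mem_left _ _ (Ideal.pow_mem_of_mem _ hb 4 (by simp)))
  have hwa : w * a ^ 2 ∈ maximalIdeal S :=
    Ideal.mul_mem_left _ _ (Ideal.pow_mem_of_mem _ ha 2 two_pos)
  have hXY : (c - w * a ^ 2) * ((c + w * a ^ 2) * v) = b ^ 4 := by
    linear_combination b ^ 4 * hv - v * h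
  have hrel : IsRelPrime (c - w * a ^ 2) ((c + w * a ^ 2) * v) := by
    intro d hd1 hd2
    have hda : d ∣ a ^ 2 := by
      have : d ∣ (2 * w) * a ^ 2 := by
        rw [show 2 * w * a ^ 2 = B * ((c + w * a ^ 2) * v) - (c - w * a ^ 2) by
          linear_combination -(c + w * a ^ 2) * hv]
        exact dvd_sub (hd2.mul_left _) hd1
      exact (h2.mul hw).dvd_mul_left.mp this
    exact (hab.pow (m := 2) (n := 4)) hda (hXY ▸ hd1.mul_right _)
  let _ := UniqueFactorizationMonoid.toGCDMonoid S
  obtain ⟨s, u, hs⟩ := exists_associated_pow_of_mul_eq_pow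
    (gcd_isUnit_iff_isRelPrime.mpr hrel) hXY
  obtain ⟨t, v', ht⟩ := exists_associated_pow_of_mul_eq_pow
    (gcd_isUnit_iff_isRelPrime.mpr hrel.symm) ((mul_comm _ _).trans hXY)
  have hst : s * t ∣ b := by
    refine (IsIntegrallyClosed.pow_dvd_pow_iff (n := 4) (by simp)).mp ⟨u * v', ?_⟩
    rw [← hXY, ← hs, ← ht]
    ring
  have hsm : s ∈ maximalIdeal S := by
    refine Ideal.IsPrime.mem_of_pow_mem inferInstance 4 ?_
    rw [← Ideal.mul_unit_mem_iff_mem _ u.isUnit, hs]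
    exact sub_mem hc hwa
  have htm : t ∈ maximalIdeal S := by
    refine Ideal.IsPrime.mem_of_pow_mem inferInstance 4 ?_
    rw [← Ideal.mul_unit_mem_iff_mem _ v'.isUnit, ht]
    exact Ideal.mul_mem_right _ _ (add_mem hc hwa)
  refine ⟨2 * w * B * v', -(2 * w * u), t, s, 2 * w * a, ((h2.mul hw).mul hB).mul v'.isUnit,
    ((h2.mul hw).mul u.isUnit).neg, ?_, htm, hsm, ?_, fun hsn ↦ hbn ?_⟩
  · linear_combination 2 * w * B * ht - 2 * w * hs + (c + w * a ^ 2) * 2 * w * hv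
  · refine (hrel.of_dvd_left ?_).symm.of_dvd_left ?_
    · exact (dvd_pow_self s (by simp)).trans ⟨u, hs.symm⟩
    · exact (dvd_pow_self t (by simp)).trans ⟨v', ht.symm⟩
  · obtain ⟨e, rfl⟩ := hst
    rw [pow_succ]
    exact Ideal.mul_mem_right _ _ (Ideal.mul_mem_mul hsn htm)

theorem Prime.algebraMap_of_flat_of_maximalIdeal_eq_span_pair {R S : Type*} [CommRing R]
    [IsDomain R] [IsLocalRing R] [CommRing S] [IsLocalRing S] [IsNoetherianRing S] [Algebra R S]
    [Module.Flat R S] (hRS : (maximalIdeal R).map (algebraMap R S) = maximalIdeal S) {x y : R}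
    (hx : Prime x) (hm : maximalIdeal R = Ideal.span {x, y}) :
    IsDomain S ∧ Prime (algebraMap R S x) := by
  have hmS : maximalIdeal S = Ideal.span {algebraMap R S x, algebraMap R S y} := by
    rw [← hRS, hm, Ideal.map_span, Set.image_pair]
  have hxS : algebraMap R S x ∈ S⁰ := by
    have := IsSMulRegular.of_flat (S := S)
      (Module.Flat.isSMulRegular_of_nonZeroDivisors (M := R) (mem_nonZeroDivisors_of_ne_zero hx.ne_zero))
    rw [mem_nonZeroDivisors_iff_right]
    intro z hz
    exact this (by simpa [mul_comm] using hz)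
  have hxm : algebraMap R S x ∈ maximalIdeal S := by
    rw [hmS]; exact Ideal.subset_span (by simp)
  have hp : (Ideal.span {algebraMap R S x}).IsPrime := by
    by_cases hyx : y ∈ Ideal.span {x}
    · have : Ideal.span {algebraMap R S x} = maximalIdeal S := by
        obtain ⟨r, hr⟩ := Ideal.mem_span_singleton.mp hyx
        rw [hmS, Ideal.span_insert, eq_comm, sup_eq_left, Ideal.span_singleton_le_iff_mem, hr,
          map_mul]
        exact Ideal.mul_mem_right _ _ (Ideal.mem_span_singleton_self _)
      rw [this]
      infer_instance
    · let B := S ⧸ Ideal.span {algebraMap R S x}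
      have : Nontrivial B := Ideal.Quotient.nontrivial_iff.mpr
        (ne_top_of_le_ne_top Ideal.IsPrime.ne_top'
          ((Ideal.span_singleton_le_iff_mem (I := maximalIdeal S)).mpr hxm))
      have : IsLocalRing B := .of_surjective' (Ideal.Quotient.mk _) Ideal.Quotient.mk_surjective
      have hmB : maximalIdeal B = Ideal.span {Ideal.Quotient.mk _ (algebraMap R S y)} := by
        have : (maximalIdeal S).map (Ideal.Quotient.mk (Ideal.span {algebraMap R S x})) =
            maximalIdeal B :=
          IsLocalRing.map_maximalIdeal_of_surjective _ Ideal.Quotient.mk_surjective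
        rw [← this, hmS, Ideal.map_span, Set.image_pair, Ideal.Quotient.eq_zero_iff_mem.mpr
          (Ideal.mem_span_singleton_self (algebraMap R S x)), Ideal.span_insert_zero]
      suffices IsDomain B from (Ideal.Quotient.isDomain_iff_prime _).mp this
      refine IsLocalRing.isDomain_of_isPrime_span_singleton
        (x := Ideal.Quotient.mk _ (algebraMap R S y)) ?_ (hmB ▸ inferInstance)
      have hy (r : R) (hr : x ∣ y * r) : x ∣ r :=
        (hx.dvd_or_dvd hr).resolve_left fun h ↦ hyx (Ideal.mem_span_singleton.mpr h)
      rw [mem_nonZeroDivisors_iff_right]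
      intro z hz
      obtain ⟨z, rfl⟩ := Ideal.Quotient.mk_surjective z
      rw [← map_mul, Ideal.Quotient.eq_zero_iff_mem, Ideal.mem_span_singleton, mul_comm] at hz
      rw [Ideal.Quotient.eq_zero_iff_mem, Ideal.mem_span_singleton]
      exact Module.Flat.dvd_of_dvd_mul hy hz
  have hS := IsLocalRing.isDomain_of_isPrime_span_singleton hxS hp
  exact ⟨hS, (Ideal.span_singleton_prime (nonZeroDivisors.ne_zero hxS)).mp hp⟩

theorem IsRelPrime.algebraMap_of_flat {R S : Type*} [CommRing R] [IsDomain R]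
    [DecompositionMonoid R] [CommRing S] [IsDomain S] [Algebra R S] [Module.Flat R S]
    [FaithfulSMul R S] {a b : R} (hb : b ≠ 0)
    (h : IsRelPrime a b) : IsRelPrime (algebraMap R S a) (algebraMap R S b) := by
  rintro d ⟨a', ha'⟩ ⟨b', hb'⟩
  have hb0 : algebraMap R S b ≠ 0 := by simpa using hb
  have hdvd : algebraMap R S b ∣ b' := by
    refine Module.Flat.dvd_of_dvd_mul (y := a) (fun r hr ↦ h.symm.dvd_of_dvd_mul_left hr) ⟨a', ?_⟩
    rw [ha', hb']
    ring
  obtain ⟨e, he⟩ := hdvd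
  refine IsUnit.of_mul_eq_one e (mul_left_cancel₀ hb0 ?_)
  linear_combination -hb' - d * he

theorem IsLocalRing.false_of_mul_pow_four_add_mul_pow_four_eq_sq.{u} (n : ℕ) :
    ∀ {R : Type u} [CommRing R] [IsDomain R] [IsLocalRing R] [IsNoetherianRing R] {x y : R},
      Prime x → maximalIdeal R = Ideal.span {x, y} → IsUnit (2 : R) →
      ∀ {A B a b c : R}, IsUnit A → IsUnit B → A * a ^ 4 + B * b ^ 4 = c ^ 2 →
      a ∈ maximalIdeal R → b ∈ maximalIdeal R → IsRelPrime a b → b ∉ maximalIdeal R ^ n →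
      False := by
  induction n with
  | zero => intro R _ _ _ _ x y hx hm h2 A B a b c hA hB h ha hb hab hbn; simp at hbn
  | succ n ih =>
    intro R _ _ _ _ x y hx hm h2 A B a b c hA hB h ha hb hab hbn
    obtain ⟨S, _, _, _, _, _, _, hRS, w, hw⟩ := exists_flat_extension_sqrt h2 hA
    have := uniqueFactorizationMonoid_of_maximalIdeal_eq_span_pair hx hm
    obtain ⟨_, hxS⟩ := hx.algebraMap_of_flat_of_maximalIdeal_eq_span_pair hRS hm
    have hmS : maximalIdeal S = Ideal.span {algebraMap R S x, algebraMap R S y} := by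
      rw [← hRS, hm, Ideal.map_span, Set.image_pair]
    have : Module.FaithfullyFlat R S := Module.FaithfullyFlat.of_flat_of_isLocalHom
    have hb0 : b ≠ 0 := by rintro rfl; simp at hbn
    have habS := hab.algebraMap_of_flat (S := S) hb0
    have hb0S : algebraMap R S b ≠ 0 := by simpa using hb0
    have haS : algebraMap R S a ∈ maximalIdeal S := hRS ▸ Ideal.mem_map_of_mem _ ha
    have hbS : algebraMap R S b ∈ maximalIdeal S := hRS ▸ Ideal.mem_map_of_mem _ hb
    have hbnS : algebraMap R S b ∉ maximalIdeal S ^ (n + 1) := by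
      rwa [← hRS, ← Ideal.map_pow, ← Ideal.mem_comap, Ideal.comap_map_eq_self_of_faithfullyFlat]
    have h2S : IsUnit (2 : S) := by
      simpa only [map_ofNat] using h2.map (algebraMap R S)
    have hwS : IsUnit w := (isUnit_pow_iff two_ne_zero).mp (hw ▸ hA.map (algebraMap R S))
    have hS := congrArg (algebraMap R S) h
    simp only [map_add, map_mul, map_pow, ← hw] at hS
    obtain ⟨A', B', a', b', c', hA', hB', h', ha', hb', hab', hbn'⟩ :=
      have := uniqueFactorizationMonoid_of_maximalIdeal_eq_span_pair hxS hmS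
      exists_mul_pow_four_add_mul_pow_four_eq_sq h2S hwS (hB.map (algebraMap R S)) hS haS hbS habS
        hbnS
    exact ih hxS hmS h2S hA' hB' h' ha' hb' hab' hbn'

theorem IsLocalRing.dvd_or_dvd_of_pow_four_add_pow_four_eq_sq_of_maximalIdeal_eq_span_pair
    {R : Type*} [CommRing R] [IsDomain R] [IsLocalRing R] [IsNoetherianRing R] {x y : R}
    (hx : Prime x) (hm : maximalIdeal R = Ideal.span {x, y}) (h2 : IsUnit (2 : R)) {a b c : R}
    (h : a ^ 4 + b ^ 4 = c ^ 2) : a ∣ b ∨ b ∣ a := by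
  have := uniqueFactorizationMonoid_of_maximalIdeal_eq_span_pair hx hm
  by_cases ha : a = 0
  · exact .inr (ha ▸ dvd_zero b)
  obtain ⟨a, b, g, hab, rfl, rfl⟩ := UniqueFactorizationMonoid.exists_reduced_factors a ha b
  have hg : g ≠ 0 := left_ne_zero_of_mul ha
  obtain ⟨c, rfl⟩ : g ^ 2 ∣ c := by
    refine (IsIntegrallyClosed.pow_dvd_pow_iff two_ne_zero).mp ⟨a ^ 4 + b ^ 4, ?_⟩
    linear_combination -h
  have h' : 1 * a ^ 4 + 1 * b ^ 4 = c ^ 2 := by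
    refine mul_left_cancel₀ (pow_ne_zero 4 hg) ?_
    linear_combination h
  by_cases hau : IsUnit a
  · exact .inl (mul_dvd_mul_left g hau.dvd)
  by_cases hbu : IsUnit b
  · exact .inr (mul_dvd_mul_left g hbu.dvd)
  have hb0 : b ≠ 0 := by
    rintro rfl
    exact hau (isRelPrime_zero_right.mp hab)
  obtain ⟨n, hn⟩ : ∃ n, b ∉ maximalIdeal R ^ n := by
    by_contra! hb
    rw [← Ideal.mem_iInf, Ideal.iInf_pow_eq_bot_of_isLocalRing _ Ideal.IsPrime.ne_top'] at hb
    exact hb0 hb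
  exact (false_of_mul_pow_four_add_mul_pow_four_eq_sq n hx hm h2 isUnit_one isUnit_one h'
    ((mem_maximalIdeal a).mpr hau) ((mem_maximalIdeal b).mpr hbu) hab hn).elim

theorem IsIntegrallyClosed.exists_isPrime_forall_not_dvd_mul {A : Type*} [CommRing A] [IsDomain A]
    [IsNoetherianRing A] [IsIntegrallyClosed A] {a b : A} (hb : b ≠ 0) (hab : ¬ b ∣ a) :
    ∃ q : Ideal A, q.IsPrime ∧ (∃ y ∈ q, ∀ z ∈ q, ∃ u ∉ q, y ∣ u * z) ∧
      ∀ s ∉ q, ¬ b ∣ s * a := by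
  have ha : Ideal.Quotient.mk (Ideal.span {b}) a ≠ 0 := by
    rwa [Ne, Ideal.Quotient.eq_zero_iff_mem, Ideal.mem_span_singleton]
  obtain ⟨P, hass, hle⟩ := exists_le_isAssociatedPrime_of_isNoetherianRing A _ ha
  obtain ⟨hP, c, hc⟩ := isAssociatedPrime_iff.mp hass
  obtain ⟨c, rfl⟩ := Ideal.Quotient.mk_surjective c
  have hcolon (s d : A) : s ∈ (⊥ : Submodule A (A ⧸ Ideal.span {b})).colon
      {Ideal.Quotient.mk (Ideal.span {b}) d} ↔ b ∣ s * d := by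
    rw [Submodule.mem_colon_singleton, Submodule.mem_bot, Algebra.smul_def,
      Ideal.Quotient.algebraMap_eq, ← map_mul, Ideal.Quotient.eq_zero_iff_mem,
      Ideal.mem_span_singleton]
  have hPc (s : A) : s ∈ P ↔ b ∣ s * c := by rw [hc, hcolon]
  refine ⟨P, hP, ?_, fun s hs hbs ↦ hs (hle ((hcolon s a).mpr hbs))⟩
  by_cases hint : ∀ z ∈ P, ∃ w ∈ P, z * c = b * w
  · let K := FractionRing A
    have hb' : algebraMap A K b ≠ 0 := by simpa using hb
    have hbP : b ∈ P := (hPc b).mpr (dvd_mul_right b c)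
    have : IsIntegral A (algebraMap A K c / algebraMap A K b) := by
      refine isIntegral_of_smul_mem_submodule (Submodule.map (Algebra.linearMap A K) P)
        (Submodule.ne_bot_iff _ |>.mpr ⟨_, ⟨b, hbP, rfl⟩, hb'⟩)
        ((IsNoetherian.noetherian P).map _) _ ?_
      rintro _ ⟨z, hz, rfl⟩
      obtain ⟨w, hw, hzw⟩ := hint z hz
      refine ⟨w, hw, ?_⟩
      have := congrArg (algebraMap A K) hzw
      simp only [map_mul] at this
      rw [Algebra.linearMap_apply, Algebra.linearMap_apply, smul_eq_mul, div_mul_eq_mul_div,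
        eq_div_iff hb']
      linear_combination -this
    obtain ⟨e, he⟩ := IsIntegrallyClosed.algebraMap_eq_of_integral this
    refine absurd ((hPc 1).mpr ⟨e, IsFractionRing.injective A K ?_⟩)
      ((Ideal.ne_top_iff_one P).mp hP.ne_top)
    rw [one_mul, map_mul, he, mul_div_cancel₀ _ hb']
  · push Not at hint
    obtain ⟨y, hy, hyw⟩ := hint
    obtain ⟨u, hu⟩ := (hPc y).mp hy
    refine ⟨y, hy, fun z hz ↦ ⟨u, fun huP ↦ hyw u huP hu, ?_⟩⟩
    obtain ⟨w, hw⟩ := (hPc z).mp hz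
    refine ⟨w, mul_left_cancel₀ hb ?_⟩
    linear_combination y * hw - z * hu

theorem IsLocalRing.exists_isPrime_of_isIntegrallyClosed_quotient {R : Type*} [CommRing R]
    [IsDomain R] [IsLocalRing R] [IsNoetherianRing R] {x : R} (hx : Prime x)
    [IsIntegrallyClosed (R ⧸ Ideal.span {x})] {a b : R} (hxb : ¬ x ∣ b) (hab : ¬ b ∣ a) :
    ∃ q : Ideal R, q.IsPrime ∧ x ∈ q ∧
      (∃ y ∈ q, ∀ z ∈ q, ∃ u ∉ q, u * z ∈ Ideal.span {x, y}) ∧ ∀ s ∉ q, ¬ b ∣ s * a := by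
  have : (Ideal.span {x}).IsPrime := (Ideal.span_singleton_prime hx.ne_zero).mpr hx
  let π := Ideal.Quotient.mk (Ideal.span {x})
  have hπ (z : R) : π z = 0 ↔ x ∣ z := by
    rw [Ideal.Quotient.eq_zero_iff_mem, Ideal.mem_span_singleton]
  by_contra! H
  have hpow (n : ℕ) : ∃ r d, a = b * r + x ^ n * d := by
    induction n with
    | zero => exact ⟨0, a, by simp⟩
    | succ n ih =>
      obtain ⟨r, d, hd⟩ := ih
      by_cases hbd : π b ∣ π d
      · obtain ⟨e, he⟩ := hbd
        obtain ⟨e, rfl⟩ := Ideal.Quotient.mk_surjective e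
        rw [← sub_eq_zero, ← map_mul, ← map_sub, hπ] at he
        obtain ⟨f, hf⟩ := he
        exact ⟨r + x ^ n * e, f, by linear_combination hd + x ^ n * hf⟩
      · obtain ⟨q, hq, ⟨y, hy, hyq⟩, hqs⟩ :=
          IsIntegrallyClosed.exists_isPrime_forall_not_dvd_mul ((hπ b).not.mpr hxb) hbd
        obtain ⟨y, rfl⟩ := Ideal.Quotient.mk_surjective y
        obtain ⟨s, hs, hsb⟩ := H (q.comap π) (q.comap_isPrime π)
          (by rw [Ideal.mem_comap, (hπ x).mpr dvd_rfl]; exact zero_mem q) ⟨y, hy, fun z hz ↦ by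
            obtain ⟨u, hu, v, huv⟩ := hyq (π z) hz
            obtain ⟨u, rfl⟩ := Ideal.Quotient.mk_surjective u
            obtain ⟨v, rfl⟩ := Ideal.Quotient.mk_surjective v
            rw [← sub_eq_zero, ← map_mul, ← map_mul, ← map_sub, hπ] at huv
            obtain ⟨w, hw⟩ := huv
            exact ⟨u, hu, Ideal.mem_span_pair.mpr ⟨w, v, by linear_combination -hw⟩⟩⟩
        refine absurd ?_ (hqs (π s) hs)
        have hdvd : b ∣ x ^ n * (s * d) := by
          rw [show x ^ n * (s * d) = s * a - b * (s * r) by rw [hd]; ring]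
          exact dvd_sub hsb (dvd_mul_right _ _)
        rw [← map_mul]
        refine map_dvd π ?_
        obtain ⟨e, he⟩ := hdvd
        obtain ⟨e, rfl⟩ : x ^ n ∣ e := hx.pow_dvd_of_dvd_mul_left n hxb ⟨_, he.symm⟩
        exact ⟨e, mul_left_cancel₀ (pow_ne_zero n hx.ne_zero) (he.trans (by ring))⟩
  refine hab ?_
  by_cases hbu : IsUnit b
  · exact hbu.dvd
  have : Nontrivial (R ⧸ Ideal.span {b}) := Ideal.Quotient.nontrivial_iff.mpr
    (mt Ideal.span_singleton_eq_top.mp hbu)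
  have : IsLocalRing (R ⧸ Ideal.span {b}) :=
    .of_surjective' (Ideal.Quotient.mk _) Ideal.Quotient.mk_surjective
  rw [← Ideal.mem_span_singleton, ← Ideal.Quotient.eq_zero_iff_mem]
  refine IsLocalRing.forall_pow_dvd (x := Ideal.Quotient.mk _ x) ?_ fun n ↦ ?_
  · rw [← IsLocalRing.map_maximalIdeal_of_surjective _ Ideal.Quotient.mk_surjective]
    exact Ideal.mem_map_of_mem _ ((mem_maximalIdeal x).mpr hx.not_isUnit)
  · obtain ⟨r, d, hd⟩ := hpow n
    refine ⟨Ideal.Quotient.mk _ d, ?_⟩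
    rw [← map_pow, ← map_mul, Ideal.Quotient.eq, Ideal.mem_span_singleton]
    exact ⟨r, by rw [hd]; ring⟩

theorem Localization.AtPrime.prime_and_maximalIdeal_eq_span_pair {R : Type*} [CommRing R]
    [IsDomain R] {q : Ideal R} [q.IsPrime] {x y : R} (hx : Prime x) (hxq : x ∈ q) (hyq : y ∈ q)
    (h : ∀ z ∈ q, ∃ u ∉ q, u * z ∈ Ideal.span {x, y}) :
    Prime (algebraMap R (Localization.AtPrime q) x) ∧
      maximalIdeal (Localization.AtPrime q) =
        Ideal.span {algebraMap R (Localization.AtPrime q) x,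
          algebraMap R (Localization.AtPrime q) y} := by
  constructor
  · have hp := (Ideal.span_singleton_prime hx.ne_zero).mpr hx
    have := IsLocalization.isPrime_of_isPrime_disjoint q.primeCompl (Localization.AtPrime q) _ hp
      (Set.disjoint_left.mpr fun s hs hsx ↦
        hs ((Ideal.span_singleton_le_iff_mem q).mpr hxq hsx))
    rw [Ideal.map_span, Set.image_singleton] at this
    refine (Ideal.span_singleton_prime ?_).mp this
    rw [Ne, FaithfulSMul.algebraMap_eq_zero_iff]
    exact hx.ne_zero
  · rw [← Localization.AtPrime.map_eq_maximalIdeal, ← Set.image_pair, ← Ideal.map_span]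
    refine le_antisymm (Ideal.map_le_iff_le_comap.mpr fun z hz ↦ ?_) (Ideal.map_mono ?_)
    · obtain ⟨u, hu, huz⟩ := h z hz
      have := Ideal.mem_map_of_mem (algebraMap R (Localization.AtPrime q)) huz
      rwa [map_mul, Ideal.unit_mul_mem_iff_mem] at this
      exact IsLocalization.map_units _ (⟨u, hu⟩ : q.primeCompl)
    · rw [Ideal.span_le, Set.pair_subset_iff]
      exact ⟨hxq, hyq⟩

theorem Localization.AtPrime.algebraMap_dvd_algebraMap_iff {R : Type*} [CommRing R] [IsDomain R]
    {q : Ideal R} [q.IsPrime] {a b : R} :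
    algebraMap R (Localization.AtPrime q) b ∣ algebraMap R (Localization.AtPrime q) a ↔
      ∃ s ∉ q, b ∣ s * a := by
  constructor
  · rintro ⟨e, he⟩
    obtain ⟨r, s, rfl⟩ := IsLocalization.exists_mk'_eq q.primeCompl e
    refine ⟨s, s.2, r, FaithfulSMul.algebraMap_injective R (Localization.AtPrime q) ?_⟩
    rw [map_mul, map_mul, he, mul_left_comm, IsLocalization.mk'_spec']
  · rintro ⟨s, hs, h⟩
    have := map_dvd (algebraMap R (Localization.AtPrime q)) h
    rw [map_mul] at this
    exact (IsLocalization.map_units _ (⟨s, hs⟩ : q.primeCompl)).dvd_mul_left.mp this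

theorem IsIntegrallyClosed.algebraMap_dvd_algebraMap_of_isIntegral_div {R S K : Type*} [CommRing R]
    [IsDomain R] [CommRing S] [IsDomain S] [IsIntegrallyClosed S] [Algebra R S] [FaithfulSMul R S]
    [Field K] [Algebra R K] [IsFractionRing R K] {a b : R} (hb : b ≠ 0)
    (h : IsIntegral R (algebraMap R K a / algebraMap R K b)) :
    algebraMap R S b ∣ algebraMap R S a := by
  have : FaithfulSMul R (FractionRing S) := .trans R S (FractionRing S)
  have := (h.map (IsFractionRing.liftAlgHom (K := K) (g := Algebra.ofId R (FractionRing S))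
    (FaithfulSMul.algebraMap_injective R (FractionRing S)))).tower_top (A := S)
  rw [map_div₀, AlgHom.commutes, AlgHom.commutes] at this
  obtain ⟨e, he⟩ := IsIntegrallyClosed.algebraMap_eq_of_integral this
  have hb' : algebraMap R (FractionRing S) b ≠ 0 := by simpa using hb
  refine ⟨e, IsFractionRing.injective S (FractionRing S) ?_⟩
  rw [map_mul, he, ← IsScalarTower.algebraMap_apply, ← IsScalarTower.algebraMap_apply,
    mul_div_cancel₀ _ hb']

theorem IsLocalRing.isIntegrallyClosed_of_quotient {R : Type*} [CommRing R]
    [IsDomain R] [IsLocalRing R] [IsNoetherianRing R] {x : R} (hx : Prime x)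
    [IsIntegrallyClosed (R ⧸ Ideal.span {x})] : IsIntegrallyClosed R := by
  have hloc {q : Ideal R} [q.IsPrime] (hxq : x ∈ q) {y : R} (hyq : y ∈ q)
      (h : ∀ z ∈ q, ∃ u ∉ q, u * z ∈ Ideal.span {x, y}) :
      IsIntegrallyClosed (Localization.AtPrime q) := by
    obtain ⟨hxS, hmS⟩ :=
      Localization.AtPrime.prime_and_maximalIdeal_eq_span_pair hx hxq hyq h
    have : IsNoetherianRing (Localization.AtPrime q) :=
      IsLocalization.isNoetherianRing q.primeCompl _ inferInstance
    have := uniqueFactorizationMonoid_of_maximalIdeal_eq_span_pair hxS hmS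
    infer_instance
  rw [isIntegrallyClosed_iff (FractionRing R)]
  intro γ hγ
  obtain ⟨a, b, hb, rfl⟩ := IsFractionRing.div_surjective (A := R) γ
  have hb0 := nonZeroDivisors.ne_zero hb
  have hp : (Ideal.span {x}).IsPrime := (Ideal.span_singleton_prime hx.ne_zero).mpr hx
  have hone : (1 : R) ∉ Ideal.span {x} := (Ideal.ne_top_iff_one _).mp hp.ne_top
  have := hloc (Ideal.mem_span_singleton_self x) (zero_mem _) fun z hz ↦ ⟨1, hone, by
    rw [one_mul]
    exact Ideal.span_mono (by simp) hz⟩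
  obtain ⟨s, hs, r, hr⟩ := Localization.AtPrime.algebraMap_dvd_algebraMap_iff
    (q := Ideal.span {x}).mp
    (IsIntegrallyClosed.algebraMap_dvd_algebraMap_of_isIntegral_div hb0 hγ)
  have hs0 : s ≠ 0 := fun h ↦ hs (h ▸ zero_mem _)
  have heq : algebraMap R (FractionRing R) a / algebraMap R (FractionRing R) b =
      algebraMap R (FractionRing R) r / algebraMap R (FractionRing R) s := by
    rw [div_eq_div_iff (by simpa using hb0) (by simpa using hs0), ← map_mul, ← map_mul,
      mul_comm a, hr, mul_comm]
  rw [heq] at hγ ⊢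
  by_cases hsr : s ∣ r
  · obtain ⟨e, rfl⟩ := hsr
    refine ⟨e, ?_⟩
    rw [map_mul, mul_div_cancel_left₀]
    simpa using hs0
  · obtain ⟨q, hq, hxq, ⟨y, hyq, hy⟩, hqs⟩ := exists_isPrime_of_isIntegrallyClosed_quotient hx
      (fun h ↦ hs (Ideal.mem_span_singleton.mpr h)) hsr
    have := hloc hxq hyq hy
    obtain ⟨t, ht, h⟩ := Localization.AtPrime.algebraMap_dvd_algebraMap_iff (q := q).mp
      (IsIntegrallyClosed.algebraMap_dvd_algebraMap_of_isIntegral_div hs0 hγ)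
    exact absurd h (hqs t ht)

theorem IsLocalRing.not_mk_dvd_mk_of_pow_four_add_pow_four_eq_sq {R : Type*} [CommRing R]
    [IsDomain R] [IsLocalRing R] [IsNoetherianRing R] {x : R} (hx : Prime x)
    [IsIntegrallyClosed (R ⧸ Ideal.span {x})] (h2 : IsUnit (2 : R)) {a b c : R}
    (h : a ^ 4 + b ^ 4 = c ^ 2) (hxb : ¬ x ∣ b) (hab : ¬ b ∣ a) :
    ¬ Ideal.Quotient.mk (Ideal.span {x}) b ∣ Ideal.Quotient.mk (Ideal.span {x}) a := by
  rintro ⟨t, ht⟩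
  obtain ⟨t, rfl⟩ := Ideal.Quotient.mk_surjective t
  rw [← map_mul, Ideal.Quotient.eq, Ideal.mem_span_singleton] at ht
  obtain ⟨e, he⟩ := ht
  obtain ⟨q, hq, hxq, ⟨y, hyq, hy⟩, hqs⟩ := exists_isPrime_of_isIntegrallyClosed_quotient hx hxb hab
  obtain ⟨hxS, hmS⟩ := Localization.AtPrime.prime_and_maximalIdeal_eq_span_pair hx hxq hyq hy
  have : IsNoetherianRing (Localization.AtPrime q) :=
    IsLocalization.isNoetherianRing q.primeCompl _ inferInstance
  have h2S : IsUnit (2 : Localization.AtPrime q) := by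
    simpa only [map_ofNat] using h2.map (algebraMap R (Localization.AtPrime q))
  have hS := congrArg (algebraMap R (Localization.AtPrime q)) h
  simp only [map_add, map_pow] at hS
  rcases dvd_or_dvd_of_pow_four_add_pow_four_eq_sq_of_maximalIdeal_eq_span_pair hxS hmS h2S hS
    with hd | hd
  · obtain ⟨s, hs, r, hr⟩ := Localization.AtPrime.algebraMap_dvd_algebraMap_iff.mp hd
    have hrq : r ∈ q := by
      by_contra hrq
      exact hqs r hrq ⟨s, by linear_combination -hr⟩
    refine hs ?_
    obtain ⟨f, hf⟩ : x ∣ s - t * r :=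
      (hx.dvd_or_dvd (a := b) ⟨e * r, by linear_combination hr + r * he⟩).resolve_left hxb
    rw [show s = t * r + x * f by linear_combination hf]
    exact add_mem (Ideal.mul_mem_left _ _ hrq) (Ideal.mul_mem_right _ _ hxq)
  · obtain ⟨s, hs, hbs⟩ := Localization.AtPrime.algebraMap_dvd_algebraMap_iff.mp hd
    exact hqs s hs hbs

theorem IsLocalRing.dvd_or_dvd_of_pow_four_add_pow_four_eq_sq_of_quotient {R : Type*} [CommRing R]
    [IsDomain R] [IsLocalRing R] [IsNoetherianRing R] {x : R} (hx : Prime x)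
    [IsIntegrallyClosed (R ⧸ Ideal.span {x})] (h2 : IsUnit (2 : R))
    (hA : ∀ a b c : R ⧸ Ideal.span {x}, a ^ 4 + b ^ 4 = c ^ 2 → a ∣ b ∨ b ∣ a)
    {a b c : R} (h : a ^ 4 + b ^ 4 = c ^ 2) : a ∣ b ∨ b ∣ a := by
  by_cases ha : a = 0
  · exact .inr (ha ▸ dvd_zero b)
  obtain ⟨n, hn⟩ := finiteMultiplicity ((mem_maximalIdeal x).mpr hx.not_isUnit) ha
  generalize n + 1 = n at hn
  clear ha
  induction n generalizing a b c with
  | zero => simp at hn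
  | succ n ih =>
    have hmk {z : R} (hz : x ∣ z) : Ideal.Quotient.mk (Ideal.span {x}) z = 0 :=
      Ideal.Quotient.eq_zero_iff_mem.mpr (Ideal.mem_span_singleton.mpr hz)
    by_cases hxa : x ∣ a
    · by_cases hxb : x ∣ b
      · obtain ⟨a, rfl⟩ := hxa
        obtain ⟨b, rfl⟩ := hxb
        obtain ⟨c, rfl⟩ : x ∣ c :=
          hx.dvd_of_dvd_pow (n := 2) ⟨x ^ 3 * (a ^ 4 + b ^ 4), by linear_combination -h⟩
        have h' : x ^ 2 * (a ^ 4 + b ^ 4) = c ^ 2 := by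
          refine mul_left_cancel₀ (pow_ne_zero 2 hx.ne_zero) ?_
          linear_combination h
        obtain ⟨c, rfl⟩ : x ∣ c :=
          hx.dvd_of_dvd_pow (n := 2) ⟨x * (a ^ 4 + b ^ 4), by linear_combination -h'⟩
        have h'' : a ^ 4 + b ^ 4 = c ^ 2 := by
          refine mul_left_cancel₀ (pow_ne_zero 2 hx.ne_zero) ?_
          linear_combination h'
        refine (ih h'' fun hd ↦ hn ?_).imp (mul_dvd_mul_left x) (mul_dvd_mul_left x)
        rw [pow_succ']
        exact mul_dvd_mul_left x hd
      · right
        by_contra hba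
        refine not_mk_dvd_mk_of_pow_four_add_pow_four_eq_sq hx h2 h hxb hba ?_
        rw [hmk hxa]
        exact dvd_zero _
    · have h' : b ^ 4 + a ^ 4 = c ^ 2 := by rw [add_comm, h]
      by_contra! hcon
      have h1 := not_mk_dvd_mk_of_pow_four_add_pow_four_eq_sq hx h2 h' hxa hcon.1
      have hxb : ¬ x ∣ b := by
        intro hxb
        rw [hmk hxb] at h1
        exact h1 (dvd_zero _)
      have h3 := not_mk_dvd_mk_of_pow_four_add_pow_four_eq_sq hx h2 h hxb hcon.2
      have := hA _ _ _ (by simpa only [map_add, map_pow] using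
        (congrArg (Ideal.Quotient.mk (Ideal.span {x})) h))
      tauto

theorem IsLocalRing.exists_mem_maximalIdeal_notMem_sq_notMem_minimalPrimes {R : Type*} [CommRing R]
    [IsLocalRing R] [IsNoetherianRing R] (h : maximalIdeal R ∉ minimalPrimes R) :
    ∃ x ∈ maximalIdeal R, x ∉ maximalIdeal R ^ 2 ∧ ∀ P ∈ minimalPrimes R, x ∉ P := by
  by_contra! H
  have hfin : (insert (maximalIdeal R ^ 2) (minimalPrimes R)).Finite :=
    (minimalPrimes.finite_of_isNoetherianRing R).insert _
  obtain ⟨P, hP, hle⟩ := ((maximalIdeal R).subset_union_prime_finite hfin (f := id)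
    (maximalIdeal R ^ 2) (maximalIdeal R ^ 2) fun P hP hne _ ↦
      Ideal.IsMinimalPrime.isPrime (hP.resolve_left hne)).mp fun x hx ↦ by
        rw [Set.mem_iUnion₂]
        by_cases hx2 : x ∈ maximalIdeal R ^ 2
        · exact ⟨_, Set.mem_insert _ _, hx2⟩
        · obtain ⟨P, hP, hxP⟩ := H x hx hx2
          exact ⟨P, Set.mem_insert_of_mem _ hP, hxP⟩
  obtain ⟨Q, hQ, -⟩ := Ideal.exists_minimalPrimes_le (bot_le : (⊥ : Ideal R) ≤ maximalIdeal R)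
  refine h ?_
  rcases hP with rfl | hP
  · have hm : maximalIdeal R = ⊥ := Submodule.eq_bot_of_le_smul_of_le_jacobson_bot
      (maximalIdeal R) (maximalIdeal R) (IsNoetherian.noetherian _)
      (by rwa [smul_eq_mul, ← pow_two]) (maximalIdeal_le_jacobson _)
    have : Q = maximalIdeal R :=
      le_antisymm (le_maximalIdeal (Ideal.IsMinimalPrime.isPrime hQ).ne_top) (hm ▸ bot_le)
    exact this ▸ hQ
  · have : P = maximalIdeal R :=
      le_antisymm (le_maximalIdeal (Ideal.IsMinimalPrime.isPrime hP).ne_top) hle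
    exact this ▸ hP

theorem IsLocalRing.spanFinrank_maximalIdeal_quotient_lt {R : Type*} [CommRing R]
    [IsLocalRing R] [IsNoetherianRing R] {x : R} (hx : x ∈ maximalIdeal R)
    (hx2 : x ∉ maximalIdeal R ^ 2) [IsLocalRing (R ⧸ Ideal.span {x})] :
    (maximalIdeal (R ⧸ Ideal.span {x})).spanFinrank < (maximalIdeal R).spanFinrank := by
  classical
  obtain ⟨s, hcard, hs⟩ := (IsNoetherian.noetherian
    (maximalIdeal R)).exists_span_finset_card_eq_spanFinrank
  obtain ⟨f, -, hf⟩ := Submodule.mem_span_finset.mp (hs ▸ hx)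
  obtain ⟨i, hi, hfi⟩ : ∃ i ∈ s, IsUnit (f i) := by
    by_contra! H
    refine hx2 (hf ▸ sum_mem fun i hi ↦ ?_)
    rw [pow_two]
    exact Ideal.mul_mem_mul ((mem_maximalIdeal _).mpr (H i hi))
      (hs ▸ Submodule.subset_span hi)
  let π := Ideal.Quotient.mk (Ideal.span {x})
  have hspan : maximalIdeal (R ⧸ Ideal.span {x}) =
      Ideal.span ((s.erase i).image π : Finset (R ⧸ Ideal.span {x})) := by
    have hmap : (maximalIdeal R).map π = maximalIdeal (R ⧸ Ideal.span {x}) :=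
      map_maximalIdeal_of_surjective _ Ideal.Quotient.mk_surjective
    have hmem (j : R) (hj : j ∈ s.erase i) :
        π j ∈ Ideal.span ((s.erase i).image π : Set (R ⧸ Ideal.span {x})) :=
      Ideal.subset_span (Finset.mem_coe.mpr (Finset.mem_image_of_mem π hj))
    refine le_antisymm ?_ (Ideal.span_le.mpr ?_)
    · rw [← hmap, ← hs, Ideal.submodule_span_eq, Ideal.map_span, Ideal.span_le]
      rintro _ ⟨j, hj, rfl⟩
      by_cases hji : j = i
      · subst hji
        rw [SetLike.mem_coe, ← Ideal.unit_mul_mem_iff_mem _ (hfi.map π), ← map_mul]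
        have : f j * j = x - ∑ k ∈ s.erase j, f k * k := by
          rw [← hf, ← Finset.add_sum_erase s _ hi]
          simp
        rw [this, map_sub, Ideal.Quotient.eq_zero_iff_mem.mpr (Ideal.mem_span_singleton_self x),
          map_sum, zero_sub, neg_mem_iff]
        refine sum_mem fun k hk ↦ ?_
        rw [map_mul]
        exact Ideal.mul_mem_left _ _ (hmem k hk)
      · exact hmem j (Finset.mem_erase.mpr ⟨hji, hj⟩)
    · intro y hy
      obtain ⟨j, hj, rfl⟩ := Finset.mem_image.mp (Finset.mem_coe.mp hy)
      rw [← hmap]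
      exact Ideal.mem_map_of_mem _ (hs ▸ Submodule.subset_span (Finset.mem_of_mem_erase hj))
  rw [hspan, ← hcard]
  refine lt_of_le_of_lt ?_ (Finset.card_erase_lt_of_mem hi)
  refine le_trans ?_ (Finset.card_image_le (f := π))
  rw [← Set.ncard_coe_finset]
  exact Submodule.spanFinrank_span_le_ncard_of_finite (Finset.finite_toSet _)

theorem IsRegularLocalRing.quotient_span_singleton {R : Type*} [CommRing R] [IsRegularLocalRing R]
    {x : R} (hx : x ∈ maximalIdeal R) (hx2 : x ∉ maximalIdeal R ^ 2) :
    IsRegularLocalRing (R ⧸ Ideal.span {x}) := by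
  have : Nontrivial (R ⧸ Ideal.span {x}) := Ideal.Quotient.nontrivial_iff.mpr
    (ne_top_of_le_ne_top Ideal.IsPrime.ne_top' ((Ideal.span_singleton_le_iff_mem _).mpr hx))
  have : IsLocalRing (R ⧸ Ideal.span {x}) :=
    .of_surjective' (Ideal.Quotient.mk _) Ideal.Quotient.mk_surjective
  refine .of_spanFinrank_maximalIdeal_le _ ?_
  have hlt := spanFinrank_maximalIdeal_quotient_lt hx hx2
  have hdim := ringKrullDim_le_ringKrullDim_quotient_add_card {x}
    (by simpa [IsLocalRing.ringJacobson_eq_maximalIdeal] using hx)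
  rw [← IsRegularLocalRing.spanFinrank_maximalIdeal, Finset.coe_singleton, Finset.card_singleton]
    at hdim
  have h1 : (((maximalIdeal (R ⧸ Ideal.span {x})).spanFinrank + 1 : ℕ) : WithBot ℕ∞) ≤
      (maximalIdeal R).spanFinrank := by exact_mod_cast hlt
  have h2 := h1.trans hdim
  push_cast at h2
  exact ENat.WithBot.add_le_add_one_right_iff.mp h2

theorem IsRegularLocalRing.maximalIdeal_notMem_minimalPrimes {R : Type*} [CommRing R]
    [IsRegularLocalRing R] (h : (maximalIdeal R).spanFinrank ≠ 0) :
    maximalIdeal R ∉ minimalPrimes R := by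
  intro hmin
  have h0 := Ideal.height_eq_zero_iff.mpr hmin
  have h1 := IsRegularLocalRing.spanFinrank_maximalIdeal (R := R)
  rw [← maximalIdeal_height_eq_ringKrullDim, h0] at h1
  exact h (by exact_mod_cast h1)

theorem IsRegularLocalRing.isField_of_spanFinrank_eq_zero {R : Type*} [CommRing R]
    [IsRegularLocalRing R] (h : (maximalIdeal R).spanFinrank = 0) : IsField R :=
  isField_iff_maximalIdeal_eq.mpr
    ((Submodule.spanFinrank_eq_zero_iff_eq_bot (IsNoetherian.noetherian _)).mp h)

theorem IsRegularLocalRing.isDomain (R : Type*) [CommRing R] [IsRegularLocalRing R] :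
    IsDomain R := by
  induction hN : (maximalIdeal R).spanFinrank using Nat.strong_induction_on generalizing R with
  | h N ih =>
    by_cases hN0 : N = 0
    · exact (isField_of_spanFinrank_eq_zero (hN.trans hN0)).isDomain
    obtain ⟨x, hx, hx2, hxP⟩ := exists_mem_maximalIdeal_notMem_sq_notMem_minimalPrimes
      (maximalIdeal_notMem_minimalPrimes (hN.trans_ne hN0))
    have := quotient_span_singleton hx hx2
    have := ih _ (hN ▸ spanFinrank_maximalIdeal_quotient_lt hx hx2) (R ⧸ Ideal.span {x}) rfl
    have hp : (Ideal.span {x}).IsPrime := (Ideal.Quotient.isDomain_iff_prime _).mp this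
    obtain ⟨P, hP, hle⟩ := Ideal.exists_minimalPrimes_le (bot_le : ⊥ ≤ Ideal.span {x})
    have hPp := Ideal.IsMinimalPrime.isPrime hP
    have hbot : P = ⊥ := by
      refine Submodule.eq_bot_of_le_smul_of_le_jacobson_bot (Ideal.span {x}) P
        (IsNoetherian.noetherian _) (fun p hp ↦ ?_)
        (((Ideal.span_singleton_le_iff_mem _).mpr hx).trans (maximalIdeal_le_jacobson _))
      obtain ⟨r, rfl⟩ := Ideal.mem_span_singleton.mp (hle hp)
      exact Ideal.mul_mem_mul (Ideal.mem_span_singleton_self x)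
        ((hPp.mem_or_mem hp).resolve_left (hxP P hP))
    exact IsDomain.of_bot_isPrime R (hbp := hbot ▸ hPp)

theorem IsRegularLocalRing.isIntegrallyClosed_and_dvd_or_dvd (R : Type*) [CommRing R] [IsDomain R]
    [IsRegularLocalRing R] (h2 : IsUnit (2 : R)) :
    IsIntegrallyClosed R ∧ ∀ a b c : R, a ^ 4 + b ^ 4 = c ^ 2 → a ∣ b ∨ b ∣ a := by
  induction hN : (maximalIdeal R).spanFinrank using Nat.strong_induction_on generalizing R with
  | h N ih =>
    by_cases hN0 : N = 0
    · have hR := isField_of_spanFinrank_eq_zero (hN.trans hN0)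
      let _ := hR.toField
      refine ⟨inferInstance, fun a b c _ ↦ ?_⟩
      by_cases ha : a = 0
      · exact .inr (ha ▸ dvd_zero b)
      · exact .inl ((isUnit_iff_ne_zero.mpr ha).dvd)
    obtain ⟨x, hx, hx2, hxP⟩ := exists_mem_maximalIdeal_notMem_sq_notMem_minimalPrimes
      (maximalIdeal_notMem_minimalPrimes (hN.trans_ne hN0))
    have := quotient_span_singleton hx hx2
    have := isDomain (R ⧸ Ideal.span {x})
    have hx0 : x ≠ 0 := fun h ↦ hx2 (h ▸ zero_mem _)
    have hxp : Prime x :=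
      (Ideal.span_singleton_prime hx0).mp ((Ideal.Quotient.isDomain_iff_prime _).mp this)
    obtain ⟨_, hA⟩ := ih _ (hN ▸ spanFinrank_maximalIdeal_quotient_lt hx hx2)
      (R ⧸ Ideal.span {x})
      (by simpa only [map_ofNat] using h2.map (Ideal.Quotient.mk (Ideal.span {x}))) rfl
    exact ⟨isIntegrallyClosed_of_quotient hxp, fun a b c ↦
      dvd_or_dvd_of_pow_four_add_pow_four_eq_sq_of_quotient hxp h2 hA⟩

theorem IsRegularLocal.isRegularLocalRing {R : Type*} [CommRing R] [IsLocalRing R]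
    (h : IsRegularLocal R) : IsRegularLocalRing R := by
  obtain ⟨_, s, hs, hcard⟩ := h
  refine .of_spanFinrank_maximalIdeal_le _ ?_
  rw [← hs]
  have : (Ideal.span (s : Set R)).spanFinrank ≤ s.card := by
    rw [← Set.ncard_coe_finset]
    exact Submodule.spanFinrank_span_le_ncard_of_finite s.finite_toSet
  exact (Nat.cast_le (α := WithBot ℕ∞).mpr this).trans hcard.le

end

/-- STATEMENT 6: If `R` is a regular local ring (reduction to the Henselian case via Henselization) of dimension `≥ 2` with residue
characteristic `≠ 2` and fraction field `K`, and `α, β ∈ K` satisfy `1 + α⁴ = β²`,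
then `α ∈ R` or `1/α ∈ R`. -/
theorem stmt7 (R K : Type*) [CommRing R] [IsDomain R] [IsLocalRing R]
    (hreg : IsRegularLocal R) (hdim : 2 ≤ ringKrullDim R)
    (hchar : ringChar (IsLocalRing.ResidueField R) ≠ 2)
    [Field K] [Algebra R K] [IsFractionRing R K]
    (α β : K) (h : 1 + α ^ 4 = β ^ 2) :
    (∃ r : R, α = algebraMap R K r) ∨ (∃ r : R, α⁻¹ = algebraMap R K r) := by
  have := hreg.isRegularLocalRing
  have h2 : IsUnit (2 : R) := by
    rw [← isUnit_map_iff (IsLocalRing.residue R), map_ofNat, isUnit_iff_ne_zero]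
    exact Ring.two_ne_zero hchar
  obtain ⟨_, hdvd⟩ := IsRegularLocalRing.isIntegrallyClosed_and_dvd_or_dvd R h2
  obtain ⟨a, b, hb, rfl⟩ := IsFractionRing.div_surjective (A := R) α
  have hb0 : algebraMap R K b ≠ 0 := by simpa using nonZeroDivisors.ne_zero hb
  have hc : (algebraMap R K b ^ 2 * β) ^ 2 = algebraMap R K (a ^ 4 + b ^ 4) := by
    rw [mul_pow, ← h, map_add, map_pow, map_pow]
    field_simp
    ring
  obtain ⟨c, hc'⟩ := IsIntegrallyClosed.exists_algebraMap_eq_of_isIntegral_pow two_pos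
    (hc ▸ isIntegral_algebraMap : IsIntegral R ((algebraMap R K b ^ 2 * β) ^ 2))
  rw [← hc', ← map_pow] at hc
  rcases hdvd a b c (IsFractionRing.injective R K hc).symm with ⟨r, rfl⟩ | ⟨r, rfl⟩
  · right
    refine ⟨r, ?_⟩
    rw [map_mul] at hb0 ⊢
    rw [inv_div, mul_div_cancel_left₀ _ (left_ne_zero_of_mul hb0)]
  · left
    refine ⟨r, ?_⟩
    rw [map_mul, mul_div_cancel_left₀ _ hb0]
end
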